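/- arXiv:1808.02974 — 8 statements merged into one kernel-verified Lean document; each statement's English description precedes it below -/
import Mathlib

section
/- Let Ext: 𝔽₂^d × 𝔽₂^n → 𝔽₂^m be a linear strong seeded (k,ε)-extractor, let V ⊆ 𝔽₂^n be a linear subspace with dim V ≥ k, and let K be uniformly distributed on V. Then for at least (1−4ε)·2^d of the seeds z ∈ 𝔽₂^d, the distribution of Ext(z,K) is exactly uniform on 𝔽₂^m (equivalently, the linear map Ext(z,·) restricted to V is surjective); moreover, for every such seed z and every v ∈ 𝔽₂^n, the distribution of Ext(z, K+v) is also exactly uniform on 𝔽₂^m. -/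
/-- The probability, over a uniformly random sample `ω : Ω`, that `X ω = a`. -/
noncomputable def prob {Ω α : Type*} (X : Ω → α) (a : α) : ℝ :=
  (Nat.card {ω : Ω // X ω = a} : ℝ) / (Nat.card Ω : ℝ)

/-- Statistical distance between the distributions of `X` and `Y` (coins uniform). -/
noncomputable def SD {Ω₁ Ω₂ α : Type*} [Fintype α] (X : Ω₁ → α) (Y : Ω₂ → α) : ℝ :=
  (1 / 2 : ℝ) * ∑ a : α, |prob X a - prob Y a|

/-- `Ext : 𝔽₂^d × 𝔽₂^n → 𝔽₂^m` is a strong seeded `(k,ε)`-extractor: for every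
`(n,k)`-source `X` (every point probability at most `2⁻ᵏ`), the joint distribution
`(S, Ext(S, X))` with an independent uniform seed `S` is `ε`-close to `(S, U_m)`. -/
def IsStrongSeededExtractor {d n m : ℕ}
    (Ext : (Fin d → ZMod 2) → (Fin n → ZMod 2) → (Fin m → ZMod 2)) (k : ℕ) (ε : ℝ) : Prop :=
  ∀ (Ω : Type) [Fintype Ω] [Nonempty Ω], ∀ X : Ω → (Fin n → ZMod 2),
    (∀ x, prob X x ≤ ((2 : ℝ) ^ k)⁻¹) →
    SD (fun p : (Fin d → ZMod 2) × Ω => (p.1, Ext p.1 (X p.2)))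
       (id : (Fin d → ZMod 2) × (Fin m → ZMod 2) → (Fin d → ZMod 2) × (Fin m → ZMod 2)) ≤ ε

theorem prob_id {α : Type*} (a : α) : prob (id : α → α) a = (Nat.card α : ℝ)⁻¹ := by
  simp [prob]

theorem prob_le_of_injective {Ω α : Type*} {X : Ω → α} (hX : Function.Injective X) (a : α) :
    prob X a ≤ (Nat.card Ω : ℝ)⁻¹ := by
  have : Subsingleton {ω : Ω // X ω = a} :=
    ⟨fun x y => Subtype.ext (hX (x.2.trans y.2.symm))⟩
  have h : (Nat.card {ω : Ω // X ω = a} : ℝ) ≤ 1 := by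
    exact_mod_cast Finite.card_le_one_iff_subsingleton.2 this
  rw [prob, inv_eq_one_div]
  gcongr

theorem prob_prodMk {A Ω β : Type*} (E : A → Ω → β) (a : A) (b : β) :
    prob (fun p : A × Ω => (p.1, E p.1 p.2)) (a, b) = (Nat.card A : ℝ)⁻¹ * prob (E a) b := by
  let e : {p : A × Ω // (p.1, E p.1 p.2) = (a, b)} ≃ {ω : Ω // E a ω = b} :=
    { toFun := fun p => ⟨p.1.2, by
        obtain ⟨h₁, h₂⟩ := Prod.mk.inj p.2
        exact (congrArg (E · p.1.2) h₁.symm).trans h₂⟩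
      invFun := fun ω => ⟨(a, ω.1), by simp [ω.2]⟩
      left_inv := by
        rintro ⟨⟨x, ω⟩, h⟩
        have hx := (Prod.mk.inj h).1
        subst hx
        rfl
      right_inv := fun _ => rfl }
  rw [prob, prob, Nat.card_congr e, Nat.card_prod, Nat.cast_mul, ← div_div, div_right_comm,
    div_eq_inv_mul]

theorem prob_eq_inv_card_of_surjective {G H : Type*} [AddCommGroup G] [AddCommGroup H]
    [Finite G] [Finite H] (f : G →+ H) (hf : Function.Surjective f) (y : H) :
    prob f y = (Nat.card H : ℝ)⁻¹ := by
  have hfib (y : H) : Nat.card {x : G // f x = y} = Nat.card f.ker :=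
    Nat.card_congr (f.fiberEquivKerOfSurjective hf y)
  have hG : Nat.card G = Nat.card H * Nat.card f.ker := by
    have := Fintype.ofFinite H
    rw [← Nat.card_congr (Equiv.sigmaFiberEquiv f), Nat.card_sigma]
    simp [hfib]
  have hker : (Nat.card f.ker : ℝ) ≠ 0 := by exact_mod_cast Nat.card_pos.ne'
  rw [prob, hfib, hG, Nat.cast_mul, div_mul_cancel_right₀ hker]

/-- The output of a homomorphism that is not surjective has `ℓ¹`-distance at least `1/2` from
uniform, since its range misses at least half of the codomain. -/
theorem half_le_sum_abs_prob_sub {G H : Type*} [AddCommGroup G] [AddCommGroup H]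
    [Fintype H] (f : G →+ H) (hf : ¬ Function.Surjective f) :
    1 / 2 ≤ ∑ y : H, |prob f y - (Nat.card H : ℝ)⁻¹| := by
  classical
  obtain ⟨y₀, hy₀⟩ : ∃ y, y ∉ f.range := by
    simpa [Function.Surjective] using hf
  let R : Finset H := {y | y ∈ f.range}
  have hcard : R.card ≤ Rᶜ.card := by
    refine Finset.card_le_card_of_injOn (· + y₀) (fun y hy => ?_) (add_left_injective y₀).injOn
    have hy : y ∈ f.range := (Finset.mem_filter.1 hy).2
    have : y + y₀ ∉ f.range := fun h => hy₀ ((f.range.add_mem_cancel_left hy).1 h)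
    simpa [R] using this
  have hsum : (Nat.card H : ℝ) ≤ 2 * Rᶜ.card := by
    have := R.card_add_card_compl
    rw [Nat.card_eq_fintype_card]
    exact_mod_cast (by omega : Fintype.card H ≤ 2 * Rᶜ.card)
  have hpos : (0 : ℝ) < Nat.card H := by exact_mod_cast Nat.card_pos
  calc (1 / 2 : ℝ) ≤ Rᶜ.card * (Nat.card H : ℝ)⁻¹ := by
        rw [← div_eq_mul_inv, le_div_iff₀ hpos]; linarith
    _ = ∑ y ∈ Rᶜ, |prob f y - (Nat.card H : ℝ)⁻¹| := by
        rw [Finset.sum_congr rfl (g := fun _ => (Nat.card H : ℝ)⁻¹), Finset.sum_const,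
          nsmul_eq_mul]
        intro y hy
        have hy : y ∉ f.range := by simpa [R] using hy
        have : IsEmpty {x : G // f x = y} := ⟨fun x => hy ⟨x.1, x.2⟩⟩
        simp [prob]
    _ ≤ _ := Finset.sum_le_sum_of_subset_of_nonneg (Finset.subset_univ _)
        fun _ _ _ => abs_nonneg _

theorem SD_prodMk_id {A Ω β : Type*} [Fintype A] [Fintype β] (E : A → Ω → β) :
    SD (fun p : A × Ω => (p.1, E p.1 p.2)) (id : A × β → A × β) =
      (1 / 2) * ((Nat.card A : ℝ)⁻¹ * ∑ a, ∑ b, |prob (E a) b - (Nat.card β : ℝ)⁻¹|) := by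
  rw [SD, Fintype.sum_prod_type]
  congr 1
  simp_rw [Finset.mul_sum]
  refine Finset.sum_congr rfl fun a _ => Finset.sum_congr rfl fun b _ => ?_
  rw [prob_prodMk, prob_id, Nat.card_prod, Nat.cast_mul, mul_inv, ← mul_sub, abs_mul,
    abs_of_nonneg (by positivity : (0 : ℝ) ≤ (Nat.card A : ℝ)⁻¹)]

/-- for a linear strong seeded `(k,ε)`-extractor `Ext`, a subspace `V`
of dimension at least `k`, and `K` uniform on `V`: at least `(1-4ε)·2^d` seeds `z`
make `Ext(z, K)` exactly uniform on `𝔽₂^m`; moreover for every such seed `z` and every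
translation `v`, `Ext(z, K + v)` is exactly uniform as well. -/
theorem stmt_1 (d n m k : ℕ) (ε : ℝ)
    (Ext : (Fin d → ZMod 2) → (Fin n → ZMod 2) → (Fin m → ZMod 2))
    (hlin : ∀ z, IsLinearMap (ZMod 2) (Ext z))
    (hext : IsStrongSeededExtractor Ext k ε)
    (V : Submodule (ZMod 2) (Fin n → ZMod 2))
    (hdim : k ≤ Module.finrank (ZMod 2) V) :
    (1 - 4 * ε) * 2 ^ d ≤
      (({z : Fin d → ZMod 2 |
          ∀ y, prob (fun x : V => Ext z (x : Fin n → ZMod 2)) y = ((2 : ℝ) ^ m)⁻¹}).ncard : ℝ) ∧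
    ∀ z : Fin d → ZMod 2,
      (∀ y, prob (fun x : V => Ext z (x : Fin n → ZMod 2)) y = ((2 : ℝ) ^ m)⁻¹) →
      ∀ (v : Fin n → ZMod 2) (y : Fin m → ZMod 2),
        prob (fun x : V => Ext z ((x : Fin n → ZMod 2) + v)) y = ((2 : ℝ) ^ m)⁻¹ := by
  classical
  have hm : (Nat.card (Fin m → ZMod 2) : ℝ) = 2 ^ m := by simp
  have hd : (Nat.card (Fin d → ZMod 2) : ℝ) = 2 ^ d := by simp
  constructor
  · let f (z : Fin d → ZMod 2) : V →+ (Fin m → ZMod 2) :=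
      ((hlin z).mk' (Ext z) ∘ₗ V.subtype).toAddMonoidHom
    have hsource (x : Fin n → ZMod 2) :
        prob (Subtype.val : V → Fin n → ZMod 2) x ≤ ((2 : ℝ) ^ k)⁻¹ := by
      refine (prob_le_of_injective Subtype.val_injective x).trans ?_
      rw [Module.natCard_eq_pow_finrank (K := ZMod 2) (V := V)]
      simp only [Nat.card_zmod, Nat.cast_pow, Nat.cast_ofNat]
      gcongr
      norm_num
    have hSD := hext V Subtype.val hsource
    rw [SD_prodMk_id (fun z (x : V) => Ext z x), hm, hd] at hSD
    let good : Finset (Fin d → ZMod 2) :=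
      {z | ∀ y, prob (fun x : V => Ext z (x : Fin n → ZMod 2)) y = ((2 : ℝ) ^ m)⁻¹}
    have hbad (z) (hz : z ∈ goodᶜ) :
        1 / 2 ≤ ∑ y, |prob (fun x : V => Ext z (x : Fin n → ZMod 2)) y - ((2 : ℝ) ^ m)⁻¹| := by
      rw [← hm]
      refine half_le_sum_abs_prob_sub (f z) fun hsurj => ?_
      refine Finset.mem_compl.1 hz (Finset.mem_filter.2 ⟨Finset.mem_univ _, fun y => ?_⟩)
      rw [← hm]
      exact prob_eq_inv_card_of_surjective (f z) hsurj y
    have hsum : (goodᶜ.card : ℝ) * (1 / 2) ≤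
        ∑ z, ∑ y, |prob (fun x : V => Ext z (x : Fin n → ZMod 2)) y - ((2 : ℝ) ^ m)⁻¹| := by
      rw [← nsmul_eq_mul]
      exact (Finset.card_nsmul_le_sum _ _ _ hbad).trans
        (Finset.sum_le_sum_of_subset_of_nonneg (Finset.subset_univ _)
          fun _ _ _ => Finset.sum_nonneg fun _ _ => abs_nonneg _)
    have htotal : (good.card : ℝ) + goodᶜ.card = 2 ^ d := by
      rw [← hd, Nat.card_eq_fintype_card]
      exact_mod_cast good.card_add_card_compl
    have hncard : {z : Fin d → ZMod 2 | ∀ y, prob (fun x : V => Ext z (x : Fin n → ZMod 2)) y =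
        ((2 : ℝ) ^ m)⁻¹}.ncard = good.card := by
      rw [← Set.ncard_coe_finset]
      simp [good]
    rw [hncard]
    rw [mul_left_comm, inv_mul_le_iff₀ (by positivity)] at hSD
    linarith
  · intro z hz v y
    rw [← hz (y - Ext z v)]
    simp only [prob, (hlin z).map_add, eq_sub_iff_add_eq]
end

section
/- Let Ext: 𝔽₂^d × 𝔽₂^n → 𝔽₂^m be a linear strong seeded (k,ε)-extractor such that Ext(z,·) is surjective for every seed z, and let f: 𝔽₂^{d+n} → 𝔽₂^t be any affine function with output length t ≤ n−k. For s, s' ∈ 𝔽₂^m, let (Z,X) be uniformly distributed on the set {(z,x) ∈ 𝔽₂^d × 𝔽₂^n : Ext(z,x) = s} and let (Z',X') be uniformly distributed on {(z,x) : Ext(z,x) = s'}. Then SD(f(Z,X); f(Z',X')) ≤ 8ε. -/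
open Finset in
/-- A proper submodule of a finite module misses at least half of the points. -/
theorem Submodule.card_le_two_mul_card_compl {R V : Type*} [Ring R] [AddCommGroup V] [Module R V]
    [Fintype V] [DecidableEq V] (W : Submodule R V) [DecidablePred (· ∈ W)] (hW : W ≠ ⊤) :
    Fintype.card V ≤ 2 * #{y : V | y ∉ W} := by
  obtain ⟨v, hv⟩ : ∃ v, v ∉ W := by
    by_contra! h
    exact hW (Submodule.eq_top_iff'.2 h)
  have h1 : #{y : V | y ∈ W} ≤ #{y : V | y ∉ W} := by
    refine card_le_card_of_injOn (· + v) (fun y hy => ?_) (fun _ _ _ _ h => add_right_cancel h)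
    simp only [coe_filter, mem_univ, true_and, Set.mem_ofPred_eq] at hy ⊢
    rwa [W.add_mem_iff_right hy]
  have h2 := card_filter_add_card_filter_not (s := (univ : Finset V)) (· ∈ W)
  rw [card_univ] at h2
  omega

open Finset in
/-- All fibers of a surjective linear map have the same size. -/
theorem LinearMap.card_fiber_mul_card {R V W : Type*} [Ring R] [AddCommGroup V] [Module R V]
    [AddCommGroup W] [Module R W] [Fintype V] [Fintype W] [DecidableEq W] (g : V →ₗ[R] W)
    (hg : Function.Surjective g) (s : W) :
    #{x : V | g x = s} * Fintype.card W = Fintype.card V := by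
  have h1 : ∀ y ∈ (univ : Finset W), #{x : V | g x = y} = #{x : V | g x = s} := by
    intro y _
    obtain ⟨w, hw⟩ := hg (y - s)
    refine card_nbij' (· - w) (· + w) ?_ ?_ ?_ ?_ <;>
      simp +contextual [Set.MapsTo, Set.LeftInvOn, Set.RightInvOn, hw]
  have h2 := card_eq_sum_card_fiberwise (f := g) (s := univ) (t := univ) (by simp)
  rw [sum_congr rfl h1, sum_const, card_univ, card_univ, smul_eq_mul] at h2
  rw [h2, mul_comm]

/-- The kernel of a linear map `𝔽₂^n → 𝔽₂^t` has at least `2^k` elements when `t + k ≤ n`. -/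
theorem two_pow_le_card_ker {n t k : ℕ} (g : (Fin n → ZMod 2) →ₗ[ZMod 2] (Fin t → ZMod 2))
    (h : t + k ≤ n) : 2 ^ k ≤ Nat.card (LinearMap.ker g) := by
  have h1 := (LinearMap.ker g).card_eq_card_quotient_mul_card
  rw [Nat.card_congr g.quotKerEquivRange.toEquiv] at h1
  have h2 : Nat.card (LinearMap.range g) ≤ 2 ^ t := by
    refine (Nat.card_le_card_of_injective (Subtype.val : LinearMap.range g → _)
      Subtype.val_injective).trans ?_
    simp [Nat.card_eq_fintype_card]
  have h3 : Nat.card (Fin n → ZMod 2) = 2 ^ n := by simp [Nat.card_eq_fintype_card]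
  have h4 : 2 ^ t * 2 ^ k ≤ 2 ^ n := by
    rw [← pow_add]; exact Nat.pow_le_pow_right (by norm_num) h
  rw [h3] at h1
  refine Nat.le_of_mul_le_mul_left (h4.trans ?_) (by positivity : 0 < 2 ^ t)
  rw [h1, mul_comm]
  exact Nat.mul_le_mul_right _ h2

open Finset Classical in
/-- For a linear extractor, few seeds fail to map a given subspace of size at least `2^k` onto
the output space. -/
theorem IsStrongSeededExtractor.card_bad_seeds_le {d n m k : ℕ} {ε : ℝ}
    {E : (Fin d → ZMod 2) → (Fin n → ZMod 2) →ₗ[ZMod 2] (Fin m → ZMod 2)}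
    (hE : IsStrongSeededExtractor (fun z => E z) k ε)
    (K : Submodule (ZMod 2) (Fin n → ZMod 2)) (hK : 2 ^ k ≤ Nat.card K) :
    (#{z | K.map (E z) ≠ ⊤} : ℝ) / 2 ^ d ≤ 4 * ε := by
  have h := hE K Subtype.val (fun x => by
    have h1 : (Nat.card {w : K // (w : Fin n → ZMod 2) = x} : ℝ) ≤ 1 := by
      have : Subsingleton {w : K // (w : Fin n → ZMod 2) = x} :=
        ⟨fun a b => Subtype.ext (Subtype.ext (a.2.trans b.2.symm))⟩
      exact_mod_cast Finite.card_le_one_iff_subsingleton.2 this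
    have h2 : (2 : ℝ) ^ k ≤ Nat.card K := by exact_mod_cast hK
    rw [prob, ← one_div]
    exact div_le_div₀ zero_le_one h1 (by positivity) h2)
  rw [SD, Fintype.sum_prod_type] at h
  have hbad : ∀ z, K.map (E z) ≠ ⊤ → (1 / 2 : ℝ) / 2 ^ d ≤
      ∑ y, |prob (fun p : (Fin d → ZMod 2) × K => (p.1, E p.1 p.2)) (z, y) -
        prob (id : (Fin d → ZMod 2) × (Fin m → ZMod 2) → _) (z, y)| := by
    intro z hz
    have hterm : ∀ y ∈ ({y | y ∉ K.map (E z)} : Finset (Fin m → ZMod 2)),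
        |prob (fun p : (Fin d → ZMod 2) × K => (p.1, E p.1 p.2)) (z, y) -
        prob (id : (Fin d → ZMod 2) × (Fin m → ZMod 2) → _) (z, y)| = 1 / (2 ^ d * 2 ^ m) := by
      intro y hy
      have h0 : IsEmpty {p : (Fin d → ZMod 2) × K // (p.1, E p.1 p.2) = (z, y)} := by
        refine ⟨fun ⟨⟨a, w⟩, hp⟩ => ?_⟩
        simp only [Prod.mk.injEq] at hp
        obtain ⟨rfl, hp⟩ := hp
        exact (mem_filter.1 hy).2 (Submodule.mem_map.2 ⟨w, w.2, hp⟩)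
      have h1 : Nat.card {p : (Fin d → ZMod 2) × (Fin m → ZMod 2) // id p = (z, y)} = 1 := by
        simp
      rw [prob, prob, h1, Nat.card_of_isEmpty]
      simp [Nat.card_eq_fintype_card, abs_of_nonneg]
    refine le_trans ?_ (sum_le_univ_sum_of_nonneg (s := {y | y ∉ K.map (E z)})
      fun _ => abs_nonneg _)
    rw [sum_congr rfl hterm, sum_const, nsmul_eq_mul]
    have hc := (K.map (E z)).card_le_two_mul_card_compl hz
    have hc' : (2 : ℝ) ^ m ≤ 2 * #{y | y ∉ K.map (E z)} := by
      have : Fintype.card (Fin m → ZMod 2) = 2 ^ m := by simp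
      rw [this] at hc
      exact_mod_cast hc
    rw [mul_one_div, div_le_div_iff₀ (by positivity) (by positivity)]
    nlinarith [show (0 : ℝ) < 2 ^ d by positivity]
  have hsum : (#{z | K.map (E z) ≠ ⊤} : ℝ) * ((1 / 2 : ℝ) / 2 ^ d) ≤
      ∑ z, ∑ y, |prob (fun p : (Fin d → ZMod 2) × K => (p.1, E p.1 p.2)) (z, y) -
        prob (id : (Fin d → ZMod 2) × (Fin m → ZMod 2) → _) (z, y)| := by
    rw [← nsmul_eq_mul, ← sum_const]
    refine le_trans (sum_le_sum fun z hz => hbad z (mem_filter.1 hz).2)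
      (sum_le_univ_sum_of_nonneg fun _ => sum_nonneg fun _ _ => abs_nonneg _)
  have : (#{z | K.map (E z) ≠ ⊤} : ℝ) / 2 ^ d =
      2 * ((#{z | K.map (E z) ≠ ⊤} : ℝ) * ((1 / 2 : ℝ) / 2 ^ d)) := by ring
  rw [this]
  linarith

open Finset in
/-- Counting a subset of a product fiberwise over the first coordinate. -/
theorem Nat.card_subtype_prod_eq_sum {α β : Type*} [Fintype α] [Fintype β]
    (P : α × β → Prop) [DecidablePred P] :
    Nat.card {p // P p} = ∑ a, #{b | P (a, b)} := by
  rw [Nat.card_eq_fintype_card, Fintype.card_subtype, card_filter, Fintype.sum_prod_type]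
  exact sum_congr rfl fun a _ => (card_filter _ _).symm

open Finset in
/-- for a linear strong seeded `(k,ε)`-extractor `Ext` with `Ext(z,·)`
surjective for every seed, an affine function `f : 𝔽₂^{d+n} → 𝔽₂^t` with `t ≤ n - k`,
and `(Z,X)`, `(Z',X')` uniform on the preimages of `s`, `s'` respectively,
`SD(f(Z,X); f(Z',X')) ≤ 8ε`. -/
theorem stmt_4 (d n m k t : ℕ) (ε : ℝ)
    (Ext : (Fin d → ZMod 2) → (Fin n → ZMod 2) → (Fin m → ZMod 2))
    (hlin : ∀ z, IsLinearMap (ZMod 2) (Ext z))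
    (hext : IsStrongSeededExtractor Ext k ε)
    (hsurj : ∀ z, Function.Surjective (Ext z))
    (f : (Fin d → ZMod 2) × (Fin n → ZMod 2) → Fin t → ZMod 2)
    (hf : ∃ (L : ((Fin d → ZMod 2) × (Fin n → ZMod 2)) →ₗ[ZMod 2] (Fin t → ZMod 2))
        (Δ : Fin t → ZMod 2), ∀ p, f p = L p + Δ)
    (ht : t + k ≤ n)
    (s s' : Fin m → ZMod 2) :
    SD (fun q : {p : (Fin d → ZMod 2) × (Fin n → ZMod 2) // Ext p.1 p.2 = s} => f q.1)
       (fun q : {p : (Fin d → ZMod 2) × (Fin n → ZMod 2) // Ext p.1 p.2 = s'} => f q.1)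
      ≤ 8 * ε := by
  classical
  obtain ⟨L, Δ, hL⟩ := hf
  obtain ⟨E, rfl⟩ : ∃ E : (Fin d → ZMod 2) → (Fin n → ZMod 2) →ₗ[ZMod 2] (Fin m → ZMod 2),
      Ext = fun z => ⇑(E z) := ⟨fun z => (hlin z).mk' (Ext z), rfl⟩
  set K := LinearMap.ker (L ∘ₗ LinearMap.inr (ZMod 2) (Fin d → ZMod 2) (Fin n → ZMod 2)) with hKdef
  have hbad := hext.card_bad_seeds_le K (two_pow_le_card_ker _ ht)
  set bad : Finset (Fin d → ZMod 2) := {z | K.map (E z) ≠ ⊤} with hbaddef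
  have hcard : ∀ z s, (#{x | E z x = s} : ℝ) = 2 ^ n / 2 ^ m := fun z s => by
    have h := (E z).card_fiber_mul_card (hsurj z) s
    simp only [Fintype.card_pi, ZMod.card, prod_const, card_univ, Fintype.card_fin] at h
    rw [eq_div_iff (by positivity)]
    exact_mod_cast h
  set c : (Fin m → ZMod 2) → (Fin d → ZMod 2) → (Fin t → ZMod 2) → ℝ :=
    fun s z a => #{x | E z x = s ∧ f (z, x) = a} with hc
  have hprob : ∀ s a, prob (fun q : {p : (Fin d → ZMod 2) × (Fin n → ZMod 2) //
      E p.1 p.2 = s} => f q.1) a = (∑ z, c s z a) / (2 ^ d * (2 ^ n / 2 ^ m)) := by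
    intro s a
    rw [prob, Nat.card_congr (Equiv.subtypeSubtypeEquivSubtypeInter
      (fun p : (Fin d → ZMod 2) × (Fin n → ZMod 2) => E p.1 p.2 = s) (fun p => f p = a)),
      Nat.card_subtype_prod_eq_sum, Nat.card_subtype_prod_eq_sum]
    push_cast
    simp only [hcard, hc]
    simp
  have hgood : ∀ z, z ∉ bad → ∀ a, c s z a = c s' z a := by
    intro z hz a
    have hz' : K.map (E z) = ⊤ := by simpa [hbaddef] using hz
    obtain ⟨w, hwK, hw⟩ := Submodule.mem_map.1 (hz' ▸ Submodule.mem_top : s' - s ∈ K.map (E z))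
    have hw0 : L (0, w) = 0 := by simpa [hKdef] using hwK
    have hfw : ∀ x, f (z, x + w) = f (z, x) := fun x => by
      have : (z, x + w) = (z, x) + (0, w) := by simp
      rw [hL, hL, this, map_add, hw0, add_zero]
    have hfw' : ∀ x, f (z, x - w) = f (z, x) := fun x => by
      rw [← hfw (x - w), sub_add_cancel]
    simp only [hc, Nat.cast_inj]
    refine card_nbij' (· + w) (· - w) ?_ ?_ ?_ ?_ <;>
      simp +contextual [Set.MapsTo, Set.LeftInvOn, Set.RightInvOn, hw, hfw, hfw']
  have hsumc : ∀ s z, ∑ a, c s z a = 2 ^ n / 2 ^ m := by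
    intro s z
    rw [← hcard z s, card_eq_sum_card_fiberwise (f := fun x => f (z, x)) (t := univ) (by simp)]
    push_cast
    simp only [hc, filter_filter]
  have hmain : ∑ a, |∑ z, c s z a - ∑ z, c s' z a| ≤ #bad * (2 * (2 ^ n / 2 ^ m)) := by
    calc ∑ a, |∑ z, c s z a - ∑ z, c s' z a|
        ≤ ∑ a, ∑ z ∈ bad, (c s z a + c s' z a) := by
          refine sum_le_sum fun a _ => ?_
          rw [← sum_sub_distrib, ← sum_subset (subset_univ bad)
            fun z _ hz => sub_eq_zero.2 (hgood z hz a)]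
          refine (abs_sum_le_sum_abs _ _).trans (sum_le_sum fun z _ => ?_)
          refine (abs_sub _ _).trans_eq ?_
          rw [abs_of_nonneg (Nat.cast_nonneg _), abs_of_nonneg (Nat.cast_nonneg _)]
      _ = #bad * (2 * (2 ^ n / 2 ^ m)) := by
          rw [sum_comm]
          simp only [sum_add_distrib, hsumc, sum_const, nsmul_eq_mul]
          ring
  have hfinal : SD (fun q : {p : (Fin d → ZMod 2) × (Fin n → ZMod 2) // E p.1 p.2 = s} => f q.1)
      (fun q : {p : (Fin d → ZMod 2) × (Fin n → ZMod 2) // E p.1 p.2 = s'} => f q.1)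
      ≤ #bad / 2 ^ d := by
    have hN : (0 : ℝ) < 2 ^ n / 2 ^ m := by positivity
    have hM : (0 : ℝ) < 2 ^ d * (2 ^ n / 2 ^ m) := by positivity
    simp only [SD, hprob, ← sub_div, abs_div, abs_of_pos hM]
    rw [← sum_div]
    calc (1 / 2 : ℝ) * ((∑ a, |∑ z, c s z a - ∑ z, c s' z a|) / (2 ^ d * (2 ^ n / 2 ^ m)))
        ≤ 1 / 2 * (#bad * (2 * (2 ^ n / 2 ^ m)) / (2 ^ d * (2 ^ n / 2 ^ m))) := by gcongr
      _ = #bad / 2 ^ d := by field_simp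
  have hpos : (0 : ℝ) ≤ #bad / 2 ^ d := by positivity
  linarith
end

section
/- Let 0 < ε < 1 and let AExt: 𝔽₂^n → 𝔽₂^ℓ be an (n−t, ε)-almost perfect affine extractor. Let X be uniform on 𝔽₂^n and let f: 𝔽₂^n → 𝔽₂^j be an affine function with j ≤ t whose linear part has rank ρ_f. Then for every s ∈ 𝔽₂^ℓ and every w in the image of f, the conditional probability Pr[f(X) = w | AExt(X) = s] is well-defined and satisfies ((1−ε)/(1+ε))·2^{−ρ_f} ≤ Pr[f(X) = w | AExt(X) = s] ≤ ((1+ε)/(1−ε))·2^{−ρ_f}. -/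
/-- The conditional probability `Pr[X = a | E]` for `ω` uniform on `Ω`. -/
noncomputable def cprob {Ω α : Type*} (X : Ω → α) (a : α) (E : Set Ω) : ℝ :=
  (Nat.card {ω : Ω // ω ∈ E ∧ X ω = a} : ℝ) / (Nat.card E : ℝ)

/-- `AExt : 𝔽₂^n → 𝔽₂^m` is a `(k,ε)`-almost perfect affine extractor: for every affine
`(n,k)`-source (uniform on an affine coset `v₀ + V` with `dim V ≥ k`) and every `y`,
`|Pr[AExt(X) = y] - 2⁻ᵐ| ≤ 2⁻ᵐ · ε`. -/
def IsAlmostPerfectAffineExtractor {n m : ℕ}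
    (AExt : (Fin n → ZMod 2) → Fin m → ZMod 2) (k : ℕ) (ε : ℝ) : Prop :=
  ∀ (V : Submodule (ZMod 2) (Fin n → ZMod 2)) (v₀ : Fin n → ZMod 2),
    k ≤ Module.finrank (ZMod 2) V →
    ∀ y : Fin m → ZMod 2,
      |prob (fun x : V => AExt (v₀ + (x : Fin n → ZMod 2))) y - ((2 : ℝ) ^ m)⁻¹| ≤
        ((2 : ℝ) ^ m)⁻¹ * ε

/-- On a coset `v₀ + V` of large enough dimension, the number of preimages of `y` under an
almost perfect affine extractor is `2⁻ᵐ |V|` up to a relative error `ε`. -/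
theorem IsAlmostPerfectAffineExtractor.card_coset_bounds {n m k : ℕ} {ε : ℝ}
    {AExt : (Fin n → ZMod 2) → Fin m → ZMod 2}
    (h : IsAlmostPerfectAffineExtractor AExt k ε)
    (V : Submodule (ZMod 2) (Fin n → ZMod 2)) (v₀ : Fin n → ZMod 2)
    (hV : k ≤ Module.finrank (ZMod 2) V) (y : Fin m → ZMod 2) :
    (1 - ε) * ((2 : ℝ) ^ m)⁻¹ * 2 ^ Module.finrank (ZMod 2) V ≤
        Nat.card {x : Fin n → ZMod 2 // AExt x = y ∧ x - v₀ ∈ V} ∧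
      (Nat.card {x : Fin n → ZMod 2 // AExt x = y ∧ x - v₀ ∈ V} : ℝ) ≤
        (1 + ε) * ((2 : ℝ) ^ m)⁻¹ * 2 ^ Module.finrank (ZMod 2) V := by
  let e : {x : V // AExt (v₀ + (x : Fin n → ZMod 2)) = y} ≃
      {x : Fin n → ZMod 2 // AExt x = y ∧ x - v₀ ∈ V} :=
    { toFun := fun x => ⟨v₀ + x.1.1, x.2, by simp⟩
      invFun := fun x => ⟨⟨x.1 - v₀, x.2.2⟩, by simpa using x.2.1⟩
      left_inv := fun x => by ext; simp
      right_inv := fun x => by ext; simp }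
  have hcard : (Nat.card V : ℝ) = 2 ^ Module.finrank (ZMod 2) V := by
    rw [Module.natCard_eq_pow_finrank (K := ZMod 2) (V := V)]
    simp
  have hb := abs_le.mp (h V v₀ hV y)
  rw [prob, Nat.card_congr e, hcard] at hb
  have hpos : (0 : ℝ) < 2 ^ Module.finrank (ZMod 2) V := by positivity
  constructor
  · rw [← le_div_iff₀ hpos]
    linarith [hb.1]
  · rw [← div_le_iff₀ hpos]
    linarith [hb.2]

/-- for an `(n-t, ε)`-almost perfect affine extractor `AExt` (`0 < ε < 1`),
`X` uniform on `𝔽₂^n`, and an affine function `f = L + Δ` with `j ≤ t` outputs and linear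
part of rank `ρ_f`, for every `s` and every `w` in the image of `f` the conditional
probability `Pr[f(X) = w | AExt(X) = s]` is well-defined (the conditioning event is
nonempty) and lies between `((1-ε)/(1+ε))·2^{-ρ_f}` and `((1+ε)/(1-ε))·2^{-ρ_f}`. -/
theorem stmt_6 (n t j ℓ : ℕ) (ε : ℝ) (hε0 : 0 < ε) (hε1 : ε < 1) (htn : t ≤ n)
    (AExt : (Fin n → ZMod 2) → Fin ℓ → ZMod 2)
    (hext : IsAlmostPerfectAffineExtractor AExt (n - t) ε)
    (f : (Fin n → ZMod 2) → Fin j → ZMod 2)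
    (L : (Fin n → ZMod 2) →ₗ[ZMod 2] (Fin j → ZMod 2)) (Δ : Fin j → ZMod 2)
    (hf : ∀ x, f x = L x + Δ)
    (hj : j ≤ t)
    (s : Fin ℓ → ZMod 2) (w : Fin j → ZMod 2) (hw : w ∈ Set.range f) :
    {x : Fin n → ZMod 2 | AExt x = s}.Nonempty ∧
    (1 - ε) / (1 + ε) * ((2 : ℝ) ^ Module.finrank (ZMod 2) (LinearMap.range L))⁻¹ ≤
      cprob f w {x : Fin n → ZMod 2 | AExt x = s} ∧
    cprob f w {x : Fin n → ZMod 2 | AExt x = s} ≤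
      (1 + ε) / (1 - ε) * ((2 : ℝ) ^ Module.finrank (ZMod 2) (LinearMap.range L))⁻¹ := by
  obtain ⟨x₀, rfl⟩ := hw
  have hrank := L.finrank_range_add_finrank_ker
  have hrange : Module.finrank (ZMod 2) (LinearMap.range L) ≤ j := by
    simpa using Submodule.finrank_le (LinearMap.range L)
  have hfin := hrank
  rw [Module.finrank_fin_fun] at hfin
  obtain ⟨hA₁, hA₂⟩ := hext.card_coset_bounds (LinearMap.ker L) x₀ (by omega) s
  obtain ⟨hB₁, hB₂⟩ := hext.card_coset_bounds ⊤ 0 (by simp) s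
  have hA : Nat.card {x : Fin n → ZMod 2 // AExt x = s ∧ x - x₀ ∈ LinearMap.ker L} =
      Nat.card {x : Fin n → ZMod 2 // x ∈ {x | AExt x = s} ∧ f x = f x₀} :=
    Nat.card_congr (Equiv.subtypeEquivRight fun x => by simp [hf, sub_eq_zero])
  have hB : Nat.card {x : Fin n → ZMod 2 //
        AExt x = s ∧ x - 0 ∈ (⊤ : Submodule (ZMod 2) (Fin n → ZMod 2))} =
      Nat.card {x : Fin n → ZMod 2 | AExt x = s} :=
    Nat.card_congr (Equiv.subtypeEquivRight fun x => by simp)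
  rw [hA] at hA₁ hA₂
  rw [hB, finrank_top, ← hrank, pow_add] at hB₁ hB₂
  rw [cprob]
  generalize hr : (2 : ℝ) ^ Module.finrank (ZMod 2) (LinearMap.range L) = r at *
  generalize hk : (2 : ℝ) ^ Module.finrank (ZMod 2) (LinearMap.ker L) = q at *
  have hr₀ : 0 < r := hr ▸ by positivity
  have hq₀ : 0 < q := hk ▸ by positivity
  have hp₀ : 0 < ((2 : ℝ) ^ ℓ)⁻¹ := by positivity
  generalize ((2 : ℝ) ^ ℓ)⁻¹ = p at *
  have h₁ : 0 < 1 - ε := by linarith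
  have h₂ : 0 < 1 + ε := by linarith
  have hB₀ : (0 : ℝ) < Nat.card {x : Fin n → ZMod 2 | AExt x = s} :=
    lt_of_lt_of_le (by positivity) hB₁
  refine ⟨?_, ?_, ?_⟩
  · have := (Nat.card_pos_iff.mp (Nat.cast_pos.mp hB₀)).1
    exact Set.nonempty_coe_sort.mp this
  · rw [le_div_iff₀ hB₀]
    calc _ ≤ (1 - ε) / (1 + ε) * r⁻¹ * ((1 + ε) * p * (r * q)) := by gcongr
      _ = (1 - ε) * p * q := by field_simp
      _ ≤ _ := hA₁
  · rw [div_le_iff₀ hB₀]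
    calc _ ≤ (1 + ε) * p * q := hA₂
      _ = (1 + ε) / (1 - ε) * r⁻¹ * ((1 - ε) * p * (r * q)) := by field_simp
      _ ≤ _ := by gcongr
end

section
/- Let AExt: 𝔽₂^n → 𝔽₂^ℓ be a surjective (n−t, ε/2)-almost perfect affine extractor, and let (Enc, Dec) be a stochastic affine erasure-correcting code with encoder Enc: 𝔽₂^n × R → 𝔽₂^N that tolerates N−r erasures with failure probability at most δ. Define Share(s) = Enc(X, ρ) where X is uniform on AExt^{−1}(s) and ρ is uniform on R, independent; define Recst(ṽ) = AExt(Dec(ṽ)). Then: (adaptive privacy) for every deterministic adaptive adversary that reads at most t coordinates of the share vector, choosing each next index as a function of the bits observed so far, and for every pair of secrets s₀, s₁ ∈ 𝔽₂^ℓ, the statistical distance between the adversary's view (transcript of observed bits) when the shared secret is s₀ and its view when the shared secret is s₁ is at most ε; and (reconstruction) for every secret s and every erasure pattern erasing at most N−r coordinates of Share(s), Recst outputs s with probability at least 1−δ. -/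
/-- The transcript (view) of a deterministic adaptive adversary reading `q` coordinates
of the vector `v : 𝔽₂^N`: the `i`-th index read is a function `Adv i` of the `i` bits
observed so far; the view records the `q` observed bits in order. -/
def advView {N q : ℕ} (Adv : (i : Fin q) → (Fin i.val → ZMod 2) → Fin N)
    (v : Fin N → ZMod 2) : Fin q → ZMod 2
  | i => v (Adv i (fun j => advView Adv v ⟨j.val, j.isLt.trans i.isLt⟩))
termination_by i => i.val
decreasing_by exact j.isLt

lemma prob_nonneg {Ω α : Type*} (X : Ω → α) (a : α) : 0 ≤ prob X a := by
  unfold prob; positivity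

lemma sum_prob {Ω α : Type*} [Finite Ω] [Nonempty Ω] [Fintype α] (X : Ω → α) :
    ∑ a, prob X a = 1 := by
  have h : ∑ a, Nat.card {ω : Ω // X ω = a} = Nat.card Ω := by
    rw [← Nat.card_sigma, Nat.card_congr (Equiv.sigmaFiberEquiv X)]
  have hpos : (Nat.card Ω : ℝ) ≠ 0 := by exact_mod_cast Nat.card_pos.ne'
  simp only [prob]
  rw [← Finset.sum_div, ← Nat.cast_sum, h, div_self hpos]

lemma card_subtype_prod {A B : Type*} [Fintype A] [Finite B] (p : A × B → Prop) :
    Nat.card {ω : A × B // p ω} = ∑ a, Nat.card {b : B // p (a, b)} := by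
  rw [← Nat.card_sigma]
  exact Nat.card_congr
    { toFun := fun ω => ⟨ω.1.1, ω.1.2, ω.2⟩
      invFun := fun σ => ⟨(σ.1, σ.2.1), σ.2.2⟩
      left_inv := fun _ => rfl
      right_inv := fun _ => rfl }

lemma card_subtype_prod' {A B : Type*} [Finite A] [Fintype B] (p : A × B → Prop) :
    Nat.card {ω : A × B // p ω} = ∑ b, Nat.card {a : A // p (a, b)} :=
  (Nat.card_congr ((Equiv.prodComm A B).subtypeEquiv fun _ => Iff.rfl)).trans
    (card_subtype_prod fun ω : B × A => p ω.swap)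

/-- If a rescaling of the probability vector `P` is multiplicatively `e`-close to the
probability vector `p`, then `P` and `p` are `2e`-close in `ℓ¹`. -/
lemma sum_abs_sub_le_of_scaled_close {α : Type*} [Fintype α] {P p : α → ℝ} {k e : ℝ}
    (he : 0 ≤ e) (he' : e ≤ 1 / 2) (hP : ∑ a, P a = 1) (hp : ∑ a, p a = 1)
    (hp0 : ∀ a, 0 ≤ p a) (h : ∀ a, |k * P a - p a| ≤ e * p a) :
    ∑ a, |P a - p a| ≤ 2 * e := by
  have hk : |k - 1| ≤ e := by
    calc |k - 1| = |∑ a, (k * P a - p a)| := by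
          rw [Finset.sum_sub_distrib, ← Finset.mul_sum, hP, hp, mul_one]
      _ ≤ ∑ a, |k * P a - p a| := Finset.abs_sum_le_sum_abs _ _
      _ ≤ ∑ a, e * p a := Finset.sum_le_sum fun a _ => h a
      _ = e := by rw [← Finset.mul_sum, hp, mul_one]
  obtain ⟨hk1, hk2⟩ := abs_le.1 hk
  have hkpos : 1 / 2 ≤ k := by linarith
  have key : e * (k * ∑ a, |P a - p a|) ≤ e * e := by
    have hterm : ∀ a, e * (k * |P a - p a|) ≤
        e ^ 2 * p a - (k * P a - p a) * (k - 1) := by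
      intro a
      obtain ⟨h1, h2⟩ := abs_le.1 (h a)
      have hp0 := hp0 a
      have habs : k * |P a - p a| = |k * (P a - p a)| := by
        rw [abs_mul, abs_of_nonneg (by linarith : 0 ≤ k)]
      rw [habs]
      rcases abs_cases (k * (P a - p a)) with ⟨h3, -⟩ | ⟨h3, -⟩ <;> rw [h3]
      · nlinarith [mul_nonneg (sub_nonneg.2 h2) (show 0 ≤ e + (k - 1) by linarith)]
      · nlinarith [mul_nonneg (show 0 ≤ e * p a + (k * P a - p a) by linarith)
          (sub_nonneg.2 hk2)]
    calc e * (k * ∑ a, |P a - p a|) = ∑ a, e * (k * |P a - p a|) := by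
          simp only [Finset.mul_sum]
      _ ≤ ∑ a, (e ^ 2 * p a - (k * P a - p a) * (k - 1)) :=
          Finset.sum_le_sum fun a _ => hterm a
      _ = e ^ 2 - (k - 1) * (k - 1) := by
          rw [Finset.sum_sub_distrib, ← Finset.mul_sum, ← Finset.sum_mul,
            Finset.sum_sub_distrib, ← Finset.mul_sum, hP, hp]; ring
      _ ≤ e * e := by nlinarith [mul_self_nonneg (k - 1)]
  have hS : 0 ≤ ∑ a, |P a - p a| := Finset.sum_nonneg fun a _ => abs_nonneg _
  rcases he.eq_or_lt with rfl | hepos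
  · have hk : k = 1 := by linarith
    have hz : ∀ a, |P a - p a| ≤ 0 := fun a => by simpa [hk] using h a
    simpa using Finset.sum_nonpos fun a (_ : a ∈ Finset.univ) => hz a
  · have := le_of_mul_le_mul_left key hepos
    nlinarith

lemma SD_le_one {Ω₁ Ω₂ α : Type*} [Finite Ω₁] [Nonempty Ω₁] [Finite Ω₂] [Nonempty Ω₂]
    [Fintype α] (X : Ω₁ → α) (Y : Ω₂ → α) : SD X Y ≤ 1 := by
  have h : ∑ a, |prob X a - prob Y a| ≤ ∑ a, (prob X a + prob Y a) :=
    Finset.sum_le_sum fun a _ => abs_le.2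
      ⟨by linarith [prob_nonneg X a, prob_nonneg Y a],
        by linarith [prob_nonneg X a, prob_nonneg Y a]⟩
  rw [Finset.sum_add_distrib, sum_prob, sum_prob] at h
  unfold SD
  linarith

lemma SD_le_of_sum_abs_sub_le {Ω₁ Ω₂ α : Type*} [Fintype α] {X : Ω₁ → α} {Y : Ω₂ → α}
    {p : α → ℝ} {e : ℝ} (hX : ∑ a, |prob X a - p a| ≤ e) (hY : ∑ a, |prob Y a - p a| ≤ e) :
    SD X Y ≤ e := by
  have h : ∑ a, |prob X a - prob Y a| ≤ ∑ a, (|prob X a - p a| + |prob Y a - p a|) :=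
    Finset.sum_le_sum fun a _ => by
      rw [abs_sub_comm (prob Y a)]
      exact abs_sub_le _ _ _
  rw [Finset.sum_add_distrib] at h
  unfold SD
  linarith

/-- The transcript equals `w` iff the non-adaptive queries determined by `w` are answered
by `w`. -/
lemma advView_eq_iff {N q : ℕ} (Adv : (i : Fin q) → (Fin i.val → ZMod 2) → Fin N)
    (v : Fin N → ZMod 2) (w : Fin q → ZMod 2) :
    advView Adv v = w ↔
      ∀ i : Fin q, v (Adv i fun j => w ⟨j.val, j.isLt.trans i.isLt⟩) = w i := by
  constructor
  · rintro rfl i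
    exact (by rw [advView] : advView Adv v i = _).symm
  · intro h
    have hw : ∀ (m : ℕ) (hm : m < q), advView Adv v ⟨m, hm⟩ = w ⟨m, hm⟩ := by
      intro m
      induction m using Nat.strong_induction_on with
      | _ m ih =>
        intro hm
        rw [advView, ← h ⟨m, hm⟩]
        congr 2
        funext j
        exact ih j.val j.isLt _
    exact funext fun i => hw i.val i.isLt

/-- On the solution set of at most `t` affine equations, an `(n - t, e)`-almost perfect
affine extractor takes each value with nearly uniform frequency. -/
lemma abs_card_sub_le_of_affine {n m t q : ℕ} {AExt : (Fin n → ZMod 2) → Fin m → ZMod 2}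
    {e : ℝ} (hext : IsAlmostPerfectAffineExtractor AExt (n - t) e) (hq : q ≤ t)
    (M : (Fin n → ZMod 2) →ₗ[ZMod 2] (Fin q → ZMod 2)) (b : Fin q → ZMod 2)
    (s : Fin m → ZMod 2) :
    |2 ^ m * (Nat.card {x : {x // AExt x = s} // M x.1 = b} : ℝ) -
      Nat.card {x // M x = b}| ≤ e * Nat.card {x // M x = b} := by
  by_cases hb : ∃ x₀, M x₀ = b
  · obtain ⟨x₀, rfl⟩ := hb
    have hdim : n - t ≤ Module.finrank (ZMod 2) (LinearMap.ker M) := by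
      have h1 := M.finrank_range_add_finrank_ker
      have h2 := (LinearMap.range M).finrank_le
      simp only [Module.finrank_fin_fun] at h1 h2
      omega
    have h := hext (LinearMap.ker M) x₀ hdim s
    have hT : Nat.card (LinearMap.ker M) = Nat.card {x // M x = M x₀} :=
      Nat.card_congr
        ((Equiv.addLeft x₀).subtypeEquiv fun x => by simp [LinearMap.mem_ker])
    have hC : Nat.card {x : LinearMap.ker M // AExt (x₀ + (x : Fin n → ZMod 2)) = s} =
        Nat.card {x : {x // AExt x = s} // M x.1 = M x₀} :=
      Nat.card_congr
        { toFun := fun x => ⟨⟨x₀ + x.1.1, x.2⟩, by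
            have := LinearMap.mem_ker.1 x.1.2
            simp [this]⟩
          invFun := fun y => ⟨⟨y.1.1 - x₀, by simp [LinearMap.mem_ker, y.2]⟩, by
            simpa using y.1.2⟩
          left_inv := fun x => by ext; simp
          right_inv := fun y => by ext; simp }
    unfold prob at h
    rw [hT, hC] at h
    have hpos : (0 : ℝ) < Nat.card {x // M x = M x₀} := by
      have : Nonempty {x // M x = M x₀} := ⟨⟨x₀, rfl⟩⟩
      exact_mod_cast Nat.card_pos
    generalize (Nat.card {x // M x = M x₀} : ℝ) = T at *
    generalize (Nat.card {x : {x // AExt x = s} // M x.1 = M x₀} : ℝ) = C at *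
    have h2 : (0 : ℝ) < 2 ^ m := by positivity
    calc |2 ^ m * C - T| = (2 ^ m * T) * |C / T - (2 ^ m)⁻¹| := by
          rw [show 2 ^ m * C - T = 2 ^ m * T * (C / T - (2 ^ m)⁻¹) by field_simp,
            abs_mul, abs_of_pos (mul_pos h2 hpos)]
      _ ≤ (2 ^ m * T) * ((2 ^ m)⁻¹ * e) := by gcongr
      _ = e * T := by field_simp
  · have h1 : IsEmpty {x // M x = b} := ⟨fun x => hb ⟨x.1, x.2⟩⟩
    have h2 : IsEmpty {x : {x // AExt x = s} // M x.1 = b} := ⟨fun x => hb ⟨x.1.1, x.2⟩⟩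
    simp

lemma abs_card_view_sub_le {n m t q N : ℕ} {AExt : (Fin n → ZMod 2) → Fin m → ZMod 2}
    {e : ℝ} (hext : IsAlmostPerfectAffineExtractor AExt (n - t) e) (hq : q ≤ t)
    (Adv : (i : Fin q) → (Fin i.val → ZMod 2) → Fin N)
    (L : (Fin n → ZMod 2) →ₗ[ZMod 2] (Fin N → ZMod 2)) (Δ : Fin N → ZMod 2)
    (s : Fin m → ZMod 2) (w : Fin q → ZMod 2) :
    |2 ^ m * (Nat.card {x : {x // AExt x = s} // advView Adv (L x.1 + Δ) = w} : ℝ) -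
      Nat.card {x // advView Adv (L x + Δ) = w}| ≤
        e * Nat.card {x // advView Adv (L x + Δ) = w} := by
  let J : Fin q → Fin N := fun i => Adv i fun j => w ⟨j.val, j.isLt.trans i.isLt⟩
  have hiff : ∀ x, advView Adv (L x + Δ) = w ↔
      (LinearMap.funLeft (ZMod 2) (ZMod 2) J ∘ₗ L) x = fun i => w i - Δ (J i) := by
    intro x
    rw [advView_eq_iff, funext_iff]
    exact forall_congr' fun i => eq_sub_iff_add_eq.symm
  simp only [hiff]
  exact abs_card_sub_le_of_affine hext hq _ _ s

/-- The adversary's view of a sharing of `s` is `ℓ¹`-close to its view of the encoding of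
a uniformly random message. -/
lemma sum_abs_prob_view_sub_le {n m t q N : ℕ} {AExt : (Fin n → ZMod 2) → Fin m → ZMod 2}
    {e : ℝ} (he : 0 ≤ e) (he' : e ≤ 1 / 2)
    (hext : IsAlmostPerfectAffineExtractor AExt (n - t) e) (hsurj : Function.Surjective AExt)
    (hq : q ≤ t) (Adv : (i : Fin q) → (Fin i.val → ZMod 2) → Fin N)
    {R : Type*} [Fintype R] [Nonempty R] {Enc : (Fin n → ZMod 2) → R → Fin N → ZMod 2}
    (hEnc : ∀ rc : R, ∃ (L : (Fin n → ZMod 2) →ₗ[ZMod 2] (Fin N → ZMod 2))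
        (Δ : Fin N → ZMod 2), ∀ x, Enc x rc = L x + Δ)
    (s : Fin m → ZMod 2) :
    ∑ w, |prob (fun ω : {x // AExt x = s} × R => advView Adv (Enc ω.1.1 ω.2)) w -
      prob (fun ω : (Fin n → ZMod 2) × R => advView Adv (Enc ω.1 ω.2)) w| ≤ 2 * e := by
  have : Nonempty {x // AExt x = s} := let ⟨x, hx⟩ := hsurj s; ⟨⟨x, hx⟩⟩
  refine sum_abs_sub_le_of_scaled_close
    (k := 2 ^ m * Nat.card ({x // AExt x = s} × R) / Nat.card ((Fin n → ZMod 2) × R))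
    he he' (sum_prob _) (sum_prob _) (fun _ => prob_nonneg _ _) fun w => ?_
  have hcard : |2 ^ m * (Nat.card {ω : {x // AExt x = s} × R //
        advView Adv (Enc ω.1.1 ω.2) = w} : ℝ) -
      Nat.card {ω : (Fin n → ZMod 2) × R // advView Adv (Enc ω.1 ω.2) = w}| ≤
      e * Nat.card {ω : (Fin n → ZMod 2) × R // advView Adv (Enc ω.1 ω.2) = w} := by
    rw [card_subtype_prod' fun ω : {x // AExt x = s} × R => advView Adv (Enc ω.1.1 ω.2) = w,
      card_subtype_prod' fun ω : (Fin n → ZMod 2) × R => advView Adv (Enc ω.1 ω.2) = w]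
    push_cast
    rw [Finset.mul_sum, Finset.mul_sum, ← Finset.sum_sub_distrib]
    refine (Finset.abs_sum_le_sum_abs _ _).trans (Finset.sum_le_sum fun rc _ => ?_)
    obtain ⟨L, Δ, hL⟩ := hEnc rc
    simp only [hL]
    exact abs_card_view_sub_le hext hq Adv L Δ s w
  have hK : (0 : ℝ) < Nat.card ((Fin n → ZMod 2) × R) := by exact_mod_cast Nat.card_pos
  have hKs : (0 : ℝ) < Nat.card ({x // AExt x = s} × R) := by exact_mod_cast Nat.card_pos
  unfold prob
  generalize (Nat.card ((Fin n → ZMod 2) × R) : ℝ) = K at *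
  generalize (Nat.card ({x // AExt x = s} × R) : ℝ) = Ks at *
  generalize (Nat.card {ω : {x // AExt x = s} × R //
    advView Adv (Enc ω.1.1 ω.2) = w} : ℝ) = C at *
  generalize (Nat.card {ω : (Fin n → ZMod 2) × R //
    advView Adv (Enc ω.1 ω.2) = w} : ℝ) = T at *
  have hsub : 2 ^ m * Ks / K * (C / Ks) - T / K = (2 ^ m * C - T) / K := by
    field_simp
  rw [hsub, abs_div, abs_of_pos hK, ← mul_div_assoc]
  gcongr

/-- If a property holds with probability at least `c` for each fixed first component, it
holds with probability at least `c` for a uniformly random one. -/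
lemma le_prob_prod {A B α β : Type*} [Finite A] [Nonempty A] [Finite B] [Nonempty B] {c : ℝ}
    (X : A × B → α) (a : α) (Y : A → B → β) (y : A → β)
    (h : ∀ x, c ≤ prob (Y x) (y x)) (hXY : ∀ x b, Y x b = y x → X (x, b) = a) :
    c ≤ prob X a := by
  have := Fintype.ofFinite A
  have hA : (0 : ℝ) < Nat.card A := by exact_mod_cast Nat.card_pos
  have hB : (0 : ℝ) < Nat.card B := by exact_mod_cast Nat.card_pos
  unfold prob at h ⊢
  rw [card_subtype_prod, Nat.card_prod, le_div_iff₀ (by push_cast; positivity)]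
  push_cast
  have hterm : ∀ x : A, c * Nat.card B ≤ (Nat.card {b : B // X (x, b) = a} : ℝ) := by
    intro x
    refine ((le_div_iff₀ hB).1 (h x)).trans ?_
    exact_mod_cast Nat.card_le_card_of_injective _
      (Subtype.map_injective (hXY x) Function.injective_id)
  calc c * (Nat.card A * Nat.card B : ℝ) = ∑ _x : A, c * (Nat.card B : ℝ) := by
        simp [Nat.card_eq_fintype_card]; ring
    _ ≤ _ := Finset.sum_le_sum fun x _ => hterm x

/-- the secret sharing scheme `Share(s) = Enc(X, ρ)` with `X` uniform on
`AExt⁻¹(s)`, built from a surjective `(n-t, ε/2)`-almost perfect affine extractor and a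
stochastic affine erasure code tolerating `N-r` erasures with failure probability `δ`,
is adaptively `ε`-private against any deterministic adaptive adversary reading at most
`t` coordinates, and allows reconstruction (`Recst = AExt ∘ Dec`) from any `r` shares
with probability at least `1-δ`. -/
theorem stmt_7 (n t r N ℓ : ℕ) (ε δ : ℝ) (htn : t ≤ n)
    (AExt : (Fin n → ZMod 2) → Fin ℓ → ZMod 2)
    (hsurj : Function.Surjective AExt)
    (hext : IsAlmostPerfectAffineExtractor AExt (n - t) (ε / 2))
    (R : Type) [Fintype R] [Nonempty R]
    (Enc : (Fin n → ZMod 2) → R → Fin N → ZMod 2)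
    (Dec : (Fin N → Option (ZMod 2)) → Option (Fin n → ZMod 2))
    (hEncAffine : ∀ rc : R, ∃ (L : (Fin n → ZMod 2) →ₗ[ZMod 2] (Fin N → ZMod 2))
        (Δ : Fin N → ZMod 2), ∀ x, Enc x rc = L x + Δ)
    (hECC : ∀ (x : Fin n → ZMod 2) (E : Finset (Fin N)), E.card ≤ N - r →
      1 - δ ≤ prob (fun rc : R =>
        Dec (fun i => if i ∈ E then none else some (Enc x rc i))) (some x)) :
    -- adaptive privacy: views on `Share(s₀)` and `Share(s₁)` are `ε`-close
    (∀ (q : ℕ), q ≤ t → ∀ (Adv : (i : Fin q) → (Fin i.val → ZMod 2) → Fin N)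
        (s₀ s₁ : Fin ℓ → ZMod 2),
      SD (fun ω : {x : Fin n → ZMod 2 // AExt x = s₀} × R => advView Adv (Enc ω.1.1 ω.2))
         (fun ω : {x : Fin n → ZMod 2 // AExt x = s₁} × R => advView Adv (Enc ω.1.1 ω.2))
        ≤ ε) ∧
    -- reconstruction from any `r` shares
    (∀ (s : Fin ℓ → ZMod 2) (E : Finset (Fin N)), E.card ≤ N - r →
      1 - δ ≤ prob (fun ω : {x : Fin n → ZMod 2 // AExt x = s} × R =>
        (Dec (fun i => if i ∈ E then none else some (Enc ω.1.1 ω.2 i))).map AExt)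
        (some s)) := by
  have hne : ∀ s, Nonempty {x // AExt x = s} := fun s => let ⟨x, hx⟩ := hsurj s; ⟨⟨x, hx⟩⟩
  constructor
  · intro q hq Adv s₀ s₁
    have := hne s₀
    have := hne s₁
    rcases le_total 1 ε with hε | hε
    · exact (SD_le_one _ _).trans hε
    · have he : 0 ≤ ε / 2 := by
        have h := (abs_nonneg _).trans (hext ⊤ 0 (by simp) s₀)
        exact nonneg_of_mul_nonneg_right h (by positivity)
      have hview := sum_abs_prob_view_sub_le he (by linarith) hext hsurj hq Adv hEncAffine
      simp only [mul_div_cancel₀ ε (two_ne_zero' ℝ)] at hview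
      exact SD_le_of_sum_abs_sub_le (hview s₀) (hview s₁)
  · intro s E hE
    have := hne s
    exact le_prob_prod _ _ _ (fun x : {x // AExt x = s} => some x.1)
      (fun x => hECC x.1 E hE) fun x rc h => by simp only [h, Option.map_some, x.2]
end

section
/- Let AExt: 𝔽₂^n → 𝔽₂^m be an affine (k,ε)-extractor, and define AExt': 𝔽₂^{n+m} → 𝔽₂^m by AExt'(x‖y) = AExt(x) + y, where x ∈ 𝔽₂^n and y ∈ 𝔽₂^m. Then AExt' is an affine (k+m, ε)-extractor: for every random variable Z uniformly distributed on an affine subspace of 𝔽₂^{n+m} of dimension at least k+m, SD(AExt'(Z); U_m) ≤ ε, where U_m is uniform on 𝔽₂^m. -/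
/-- `AExt : 𝔽₂^n → 𝔽₂^m` is an affine `(k,ε)`-extractor: for every random variable
uniform on an affine coset `v₀ + V` of `𝔽₂^n` with `dim V ≥ k`, the output is `ε`-close
to uniform on `𝔽₂^m`. -/
def IsAffineExtractor {n m : ℕ}
    (AExt : (Fin n → ZMod 2) → Fin m → ZMod 2) (k : ℕ) (ε : ℝ) : Prop :=
  ∀ (V : Submodule (ZMod 2) (Fin n → ZMod 2)) (v₀ : Fin n → ZMod 2),
    k ≤ Module.finrank (ZMod 2) V →
    SD (fun x : V => AExt (v₀ + (x : Fin n → ZMod 2)))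
       (id : (Fin m → ZMod 2) → (Fin m → ZMod 2)) ≤ ε

/-- A distribution on a finite group is the average of its translates along any map `φ`. -/
lemma prob_eq_average_translates {G H α : Type*} [AddGroup G] [Fintype G] [Finite H] [Nonempty H]
    (φ : H → G) (X : G → α) (a : α) :
    prob X a = (∑ w : G, prob (fun u => X (w + φ u)) a) / (Fintype.card G : ℝ) := by
  have hcount : ∑ w : G, Nat.card {u : H // X (w + φ u) = a}
      = Nat.card H * Nat.card {w : G // X w = a} := by
    rw [← Nat.card_sigma, ← Nat.card_prod]
    refine Nat.card_congr
      { toFun := fun p => (p.2.1, ⟨p.1 + φ p.2.1, p.2.2⟩)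
        invFun := fun q => ⟨q.2.1 - φ q.1, q.1, by simpa using q.2.2⟩
        left_inv := ?_
        right_inv := fun q => by simp }
    rintro ⟨w, u, hu⟩
    ext1
    · simp
    · rfl
  have hH : (Nat.card H : ℝ) ≠ 0 := by exact_mod_cast Nat.card_pos.ne'
  unfold prob
  rw [← Finset.sum_div, ← Nat.cast_sum, hcount, Nat.card_eq_fintype_card (α := G), Nat.cast_mul,
    mul_div_cancel_left₀ _ hH]

/-- Statistical distance is convex: a uniform mixture of distributions `ε`-close to `Y` is
`ε`-close to `Y`. -/
lemma SD_le_of_prob_eq_average {I Ω₁ Ω₂ Ω₃ α : Type*} [Fintype I] [Nonempty I] [Fintype α]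
    {X : Ω₁ → α} {X' : I → Ω₂ → α} {Y : Ω₃ → α} {ε : ℝ}
    (hX : ∀ a, prob X a = (∑ i, prob (X' i) a) / (Fintype.card I : ℝ))
    (h : ∀ i, SD (X' i) Y ≤ ε) : SD X Y ≤ ε := by
  have hI : (0 : ℝ) < Fintype.card I := by exact_mod_cast Fintype.card_pos
  have hpt (a : α) : |prob X a - prob Y a|
      ≤ (∑ i, |prob (X' i) a - prob Y a|) / (Fintype.card I : ℝ) := by
    have hdiff : prob X a - prob Y a
        = (∑ i, (prob (X' i) a - prob Y a)) / (Fintype.card I : ℝ) := by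
      rw [hX, Finset.sum_sub_distrib, Finset.sum_const, Finset.card_univ, nsmul_eq_mul]
      field_simp
    rw [hdiff, abs_div, abs_of_pos hI]
    gcongr
    exact Finset.abs_sum_le_sum_abs _ _
  calc SD X Y
      ≤ (1 / 2 : ℝ) * ∑ a, (∑ i, |prob (X' i) a - prob Y a|) / (Fintype.card I : ℝ) := by
        unfold SD
        gcongr with a
        exact hpt a
    _ = (∑ i, SD (X' i) Y) / (Fintype.card I : ℝ) := by
        unfold SD
        rw [← Finset.sum_div, Finset.sum_comm, ← Finset.mul_sum, mul_div_assoc]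
    _ ≤ ε := by
        rw [div_le_iff₀ hI]
        calc ∑ i, SD (X' i) Y ≤ ∑ _i : I, ε := Finset.sum_le_sum fun i _ => h i
          _ = ε * Fintype.card I := by simp [mul_comm]

/-- The distance to the uniform distribution on a group is invariant under translation. -/
lemma SD_add_const_id {Ω α : Type*} [AddGroup α] [Fintype α] (X : Ω → α) (c : α) :
    SD (fun ω => X ω + c) (id : α → α) = SD X (id : α → α) := by
  unfold SD
  congr 1
  refine Fintype.sum_equiv (Equiv.subRight c) _ _ fun a => ?_
  have hunif (b : α) : prob (id : α → α) b = 1 / (Nat.card α : ℝ) := by simp [prob]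
  have hshift : prob (fun ω => X ω + c) a = prob X (a - c) := by
    simp only [prob, eq_sub_iff_add_eq]
  rw [hunif, hunif, hshift, Equiv.subRight_apply]

/-- The vectors of `W` supported on the first `n` coordinates have codimension at most `m`. -/
lemma finrank_le_finrank_comap_append_zero_add {K : Type*} [Field K] {n m : ℕ}
    (W : Submodule K (Fin (n + m) → K)) {ι : (Fin n → K) →ₗ[K] (Fin (n + m) → K)}
    (hι : ∀ x, ι x = Fin.append x 0) :
    Module.finrank K W ≤ Module.finrank K (W.comap ι) + m := by
  let P : W →ₗ[K] (Fin m → K) := (LinearMap.funLeft K K (Fin.natAdd n)).comp W.subtype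
  have happ (z : LinearMap.ker P) : ι (fun i => z.1.1 (Fin.castAdd m i)) = z.1.1 := by
    rw [hι]
    ext i
    refine Fin.addCases (fun i => ?_) (fun j => ?_) i
    · simp
    · rw [Fin.append_right]
      exact (congrFun (LinearMap.mem_ker.1 z.2) j).symm
  let Q : LinearMap.ker P →ₗ[K] W.comap ι :=
    LinearMap.codRestrict _ ((LinearMap.funLeft K K (Fin.castAdd m)).comp
      (W.subtype.comp (LinearMap.ker P).subtype)) fun z => by
        have := happ z
        change ι (fun i => z.1.1 (Fin.castAdd m i)) ∈ W
        rw [this]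
        exact z.1.2
  have hQ : Function.Injective Q := fun z z' h => by
    ext1; ext1
    rw [← happ z, ← happ z']
    exact congrArg ι (congrArg Subtype.val h)
  have hrange : Module.finrank K (LinearMap.range P) ≤ m := by
    simpa using Submodule.finrank_le (LinearMap.range P)
  have hker := LinearMap.finrank_le_finrank_of_injective hQ
  have := LinearMap.finrank_range_add_finrank_ker P
  omega

/-- if `AExt` is an affine `(k,ε)`-extractor, then
`AExt'(x‖y) = AExt(x) + y` is an affine `(k+m, ε)`-extractor on `𝔽₂^{n+m}`. -/
theorem stmt_8 (n m k : ℕ) (ε : ℝ)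
    (AExt : (Fin n → ZMod 2) → Fin m → ZMod 2)
    (hext : IsAffineExtractor AExt k ε) :
    IsAffineExtractor
      (fun z : Fin (n + m) → ZMod 2 =>
        AExt (fun i => z (Fin.castAdd m i)) + fun j => z (Fin.natAdd n j))
      (k + m) ε := by
  intro W z₀ hW
  let ι : (Fin n → ZMod 2) →ₗ[ZMod 2] (Fin (n + m) → ZMod 2) :=
    { toFun := fun x => Fin.append x 0
      map_add' := fun x y => by
        ext i; refine Fin.addCases (fun i => ?_) (fun j => ?_) i <;> simp
      map_smul' := fun c x => by
        ext i; refine Fin.addCases (fun i => ?_) (fun j => ?_) i <;> simp }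
  let V := W.comap ι
  have hV : k ≤ Module.finrank (ZMod 2) V := by
    have := finrank_le_finrank_comap_append_zero_add W (ι := ι) fun _ => rfl
    change _ ≤ Module.finrank (ZMod 2) V + m at this
    omega
  let := Fintype.ofFinite W
  refine SD_le_of_prob_eq_average
    (prob_eq_average_translates (fun u : V => (⟨ι u, u.2⟩ : W)) _) fun w => ?_
  have h := hext V (fun i => (z₀ + w.1) (Fin.castAdd m i)) hV
  rw [← SD_add_const_id _ (fun j => (z₀ + w.1) (Fin.natAdd n j))] at h
  have hfun : ∀ u : V, (fun i => (z₀ + (w.1 + ι u)) (Fin.castAdd m i))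
      = (fun i => (z₀ + w.1) (Fin.castAdd m i)) + u.1 := fun u => by
    ext i
    simp [ι, add_assoc]
  convert h using 3 with u
  refine congrArg₂ (· + ·) (congrArg AExt (hfun u)) ?_
  ext j
  simp [ι]
end

section
/- For every p ∈ [0,1) and every ξ > 0 with p + ξ < 1, there exist a constant c > 0 and N₀ ∈ ℕ such that for every N ≥ N₀ there is a stochastic affine erasure-correcting code of length N with message length m ≥ (1−p−ξ)·N, i.e., an encoder Enc: 𝔽₂^m × R → 𝔽₂^N (R a finite set of coins sampled uniformly) such that Enc(·,r) is an affine map for every fixed r ∈ R, and a deterministic decoder Dec, such that for every message x ∈ 𝔽₂^m and every erasure pattern erasing at most p·N coordinates of the codeword, Pr_r[Dec applied to the erased codeword = x] ≥ 1 − exp(−c·ξ²·N / (log N)²). -/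
open Polynomial in
/-- The authentication polynomial `∑ i, x i * X ^ (i + 1) + X ^ (d + 2)` of a message `x`. -/
noncomputable def authPoly {F : Type*} [Field F] {d : ℕ} (x : Fin d → F) : F[X] :=
  ∑ i, C (x i) * X ^ ((i : ℕ) + 1) + X ^ (d + 2)

section Counting

open Module

variable {V : Type*} [AddCommGroup V] [Module (ZMod 2) V] [Finite V]

lemma card_annihilating_dual_mul {L : ℕ} {v : Fin L → V} (hv : LinearIndependent (ZMod 2) v) :
    Nat.card {g : Dual (ZMod 2) V // ∀ j, g (v j) = 0} * 2 ^ L = 2 ^ finrank (ZMod 2) V := by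
  have e : ∀ g : Dual (ZMod 2) V, (∀ j, g (v j) = 0) ↔
      g ∈ (Submodule.span (ZMod 2) (Set.range v)).dualAnnihilator := by
    intro g
    rw [Submodule.mem_dualAnnihilator]
    refine ⟨fun h w hw => ?_, fun h j => h _ (Submodule.subset_span ⟨j, rfl⟩)⟩
    have : Submodule.span (ZMod 2) (Set.range v) ≤ LinearMap.ker g :=
      Submodule.span_le.2 (by rintro _ ⟨j, rfl⟩; exact h j)
    exact this hw
  have h1 := Subspace.finrank_add_finrank_dualAnnihilator_eq
    (Submodule.span (ZMod 2) (Set.range v))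
  rw [finrank_span_eq_card hv, Fintype.card_fin] at h1
  have h2 := Module.natCard_eq_pow_finrank (K := ZMod 2)
    (V := (Submodule.span (ZMod 2) (Set.range v)).dualAnnihilator)
  rw [Nat.card_zmod] at h2
  rw [Nat.card_congr (Equiv.subtypeEquivRight e), h2, ← h1, pow_add, mul_comm]

lemma card_annihilating_family_mul {L N : ℕ} {v : Fin L → V}
    (hv : LinearIndependent (ZMod 2) v) (E : Finset (Fin N)) :
    Nat.card {G : Fin N → Dual (ZMod 2) V // ∀ i ∉ E, ∀ j, G i (v j) = 0} * 2 ^ (L * Eᶜ.card) =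
      2 ^ (finrank (ZMod 2) V * N) := by
  classical
  let e : {G : Fin N → Dual (ZMod 2) V // ∀ i ∉ E, ∀ j, G i (v j) = 0} ≃
      ∀ i, {g : Dual (ZMod 2) V // i ∉ E → ∀ j, g (v j) = 0} :=
    Equiv.subtypePiEquivPi (p := fun i (g : Dual (ZMod 2) V) => i ∉ E → ∀ j, g (v j) = 0)
  rw [Nat.card_congr e, Nat.card_pi]
  have h1 : (2 : ℕ) ^ (L * Eᶜ.card) = ∏ i, if i ∈ E then 1 else 2 ^ L := by
    rw [Finset.prod_ite, Finset.prod_const_one, one_mul, Finset.prod_const, ← pow_mul]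
    congr 3
    ext; simp
  rw [h1, ← Finset.prod_mul_distrib, pow_mul]
  trans ∏ _i : Fin N, 2 ^ finrank (ZMod 2) V
  · refine Finset.prod_congr rfl fun i _ => ?_
    by_cases hi : i ∈ E
    · have h2 := Module.natCard_eq_pow_finrank (K := ZMod 2) (V := Dual (ZMod 2) V)
      rw [Nat.card_zmod, Subspace.dual_finrank_eq] at h2
      simp only [hi, not_true_eq_false, IsEmpty.forall_iff, if_true, mul_one]
      rw [← h2]
      exact Nat.card_congr (Equiv.subtypeUnivEquiv fun _ => trivial)
    · simp only [hi, not_false_eq_true, forall_const, if_false]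
      exact card_annihilating_dual_mul hv
  · simp

/-- A random family of functionals gives a linear code which is list-decodable, with list size
at most `2 ^ L`, from every erasure pattern leaving enough coordinates. -/
lemma exists_erasure_list_decodable (V : Type*) [AddCommGroup V] [Module (ZMod 2) V] [Finite V]
    (L N : ℕ) :
    ∃ G : Fin N → Dual (ZMod 2) V, ∀ E : Finset (Fin N),
      N + finrank (ZMod 2) V * L < L * Eᶜ.card →
        Nat.card {v : V // ∀ i ∉ E, G i v = 0} ≤ 2 ^ L := by
  classical
  set n := finrank (ZMod 2) V with hn
  have : Finite (Dual (ZMod 2) V) := Module.finite_of_finite (ZMod 2)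
  have : Fintype (Dual (ZMod 2) V) := Fintype.ofFinite _
  have : Fintype V := Fintype.ofFinite _
  by_contra! hcon
  let I : Finset (Finset (Fin N) × (Fin L → V)) := Finset.univ.filter fun q =>
    N + n * L < L * q.1ᶜ.card ∧ LinearIndependent (ZMod 2) q.2
  let B : Finset (Fin N) × (Fin L → V) → Finset (Fin N → Dual (ZMod 2) V) := fun q =>
    Finset.univ.filter fun G => ∀ i ∉ q.1, ∀ j, G i (q.2 j) = 0
  have hV : Fintype.card V = 2 ^ n := by
    rw [Module.card_eq_pow_finrank (K := ZMod 2), ZMod.card]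
  have hD : Fintype.card (Fin N → Dual (ZMod 2) V) = 2 ^ (n * N) := by
    rw [Fintype.card_fun, Module.card_eq_pow_finrank (K := ZMod 2), ZMod.card,
      Subspace.dual_finrank_eq, Fintype.card_fin, ← pow_mul]
  have hcover : (Finset.univ : Finset (Fin N → Dual (ZMod 2) V)) ⊆ I.biUnion B := by
    intro G _
    obtain ⟨E, hE, hG⟩ := hcon G
    let W : Submodule (ZMod 2) V := ⨅ i : {i // i ∉ E}, LinearMap.ker (G i)
    have hW : ∀ v, v ∈ W ↔ ∀ i ∉ E, G i v = 0 := by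
      intro v; simp [W, Submodule.mem_iInf]
    have hcard : Nat.card W = Nat.card {v : V // ∀ i ∉ E, G i v = 0} :=
      Nat.card_congr (Equiv.subtypeEquivRight hW)
    rw [← hcard, Module.natCard_eq_pow_finrank (K := ZMod 2), Nat.card_zmod] at hG
    have hL : L ≤ finrank (ZMod 2) W := ((Nat.pow_lt_pow_iff_right one_lt_two).1 hG).le
    obtain ⟨f, hf⟩ := exists_linearIndependent_of_le_finrank hL
    refine Finset.mem_biUnion.2 ⟨(E, fun j => (f j : V)), ?_, ?_⟩
    · simp only [I, Finset.mem_filter, Finset.mem_univ, true_and]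
      exact ⟨hE, hf.map' W.subtype W.ker_subtype⟩
    · simp only [B, Finset.mem_filter, Finset.mem_univ, true_and]
      exact fun i hi j => (hW _).1 (f j).2 i hi
  have hB : ∀ q ∈ I, (B q).card * 2 ^ (N + n * L + 1) ≤ 2 ^ (n * N) := by
    intro q hq
    obtain ⟨hq1, hq2⟩ := (Finset.mem_filter.1 hq).2
    have h := card_annihilating_family_mul hq2 q.1
    rw [Nat.card_eq_fintype_card, Fintype.card_subtype] at h
    rw [hn, ← h]
    exact Nat.mul_le_mul_left _ (Nat.pow_le_pow_right two_pos hq1)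
  have hI : I.card ≤ 2 ^ (N + n * L) := by
    refine (Finset.card_le_univ _).trans_eq ?_
    rw [Fintype.card_prod, Fintype.card_finset, Fintype.card_fun, hV, Fintype.card_fin,
      Fintype.card_fin, ← pow_mul, ← pow_add]
  have hle : 2 ^ (n * N) ≤ ∑ q ∈ I, (B q).card := by
    rw [← hD, ← Finset.card_univ]
    exact (Finset.card_le_card hcover).trans Finset.card_biUnion_le
  have h1 : (∑ q ∈ I, (B q).card) * 2 ^ (N + n * L + 1) ≤ 2 ^ (N + n * L) * 2 ^ (n * N) := by
    rw [Finset.sum_mul]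
    refine (Finset.sum_le_card_nsmul I _ _ hB).trans ?_
    rw [smul_eq_mul]
    exact Nat.mul_le_mul_right _ hI
  have h2 := (Nat.mul_le_mul_right (2 ^ (N + n * L + 1)) hle).trans h1
  rw [pow_succ, mul_comm (2 ^ (N + n * L)) (2 ^ (n * N)), ← mul_assoc] at h2
  have : 0 < 2 ^ (n * N) * 2 ^ (N + n * L) := by positivity
  omega

end Counting

section Authentication

open Polynomial

variable {F : Type*} [Field F] {d : ℕ}

lemma natDegree_authPoly_sum_le (x : Fin d → F) :
    (∑ i, C (x i) * X ^ ((i : ℕ) + 1)).natDegree ≤ d :=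
  natDegree_sum_le_of_forall_le _ _ fun i _ =>
    (natDegree_C_mul_X_pow_le _ _).trans i.2

lemma natDegree_authPoly_le (x : Fin d → F) : (authPoly x).natDegree ≤ d + 2 :=
  natDegree_add_le_of_degree_le ((natDegree_authPoly_sum_le x).trans (by omega))
    (natDegree_X_pow_le _)

lemma coeff_authPoly_succ (x : Fin d → F) (i : Fin d) :
    (authPoly x).coeff ((i : ℕ) + 1) = x i := by
  have hi : (i : ℕ) ≠ d + 1 := by omega
  simp only [authPoly, coeff_add, finsetSum_coeff, coeff_C_mul, coeff_X_pow, add_left_inj,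
    Fin.val_inj]
  simp [hi]

lemma authPoly_comp_sub_ne_zero [CharP F 2] (hd : Odd d) (x a : Fin d → F) (b δ : F)
    (ha : a ≠ 0) : (authPoly (x + a)).comp (X + C b) - authPoly x - C δ ≠ 0 := by
  by_cases hb : b = 0
  · subst hb
    obtain ⟨i, hi⟩ := Function.ne_iff.1 ha
    intro h
    apply hi
    have := congrArg (fun q => coeff q ((i : ℕ) + 1)) h
    simpa [coeff_authPoly_succ, coeff_C] using this
  · intro h
    apply hb
    have := congrArg (fun q => coeff q (d + 1)) h
    have h1 : ((∑ i, C ((x + a) i) * X ^ ((i : ℕ) + 1)).comp (X + C b)).coeff (d + 1) = 0 := by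
      apply coeff_eq_zero_of_natDegree_lt
      refine natDegree_comp_le.trans_lt ?_
      rw [natDegree_X_add_C, mul_one]
      exact (natDegree_authPoly_sum_le (x + a)).trans_lt (Nat.lt_succ_self d)
    have h2 : (∑ i, C (x i) * X ^ ((i : ℕ) + 1)).coeff (d + 1) = 0 :=
      coeff_eq_zero_of_natDegree_lt ((natDegree_authPoly_sum_le x).trans_lt (Nat.lt_succ_self d))
    have h3 : ((d + 2 : ℕ) : F) = 1 := by
      obtain ⟨t, rfl⟩ := hd
      have h4 : (2 : F) = 0 := CharTwo.two_eq_zero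
      push_cast
      linear_combination ((t : F) + 1) * h4
    simp only [authPoly, add_comp, X_pow_comp, coeff_sub, coeff_add, h1, h2, coeff_X_add_C_pow,
      coeff_X_pow, coeff_C, coeff_zero] at this
    rw [show d + 2 - (d + 1) = 1 by omega, Nat.choose_succ_self_right, h3] at this
    simpa using this

lemma card_authPoly_collision_le [CharP F 2] (hd : Odd d) (x a : Fin d → F) (b δ : F)
    (ha : a ≠ 0) (S : Finset F)
    (hS : ∀ r ∈ S, (authPoly (x + a)).eval (r + b) = (authPoly x).eval r + δ) :
    S.card ≤ d + 2 := by
  classical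
  have hQ := authPoly_comp_sub_ne_zero hd x a b δ ha
  have hdeg : ((authPoly (x + a)).comp (X + C b) - authPoly x - C δ).natDegree ≤ d + 2 := by
    rw [natDegree_sub_C]
    refine natDegree_sub_le_of_le ?_ (natDegree_authPoly_le x) |>.trans_eq (max_self _)
    refine natDegree_comp_le.trans ?_
    rw [natDegree_X_add_C, mul_one]
    exact natDegree_authPoly_le _
  refine (card_le_degree_of_subset_roots fun r hr => ?_).trans hdeg
  rw [mem_roots hQ, IsRoot.def]
  simp [hS r hr]

end Authentication

section Code

open Module Polynomial

lemma exists_unique_decoder {M R : Type*} {N : ℕ} (Enc : M → R → Fin N → ZMod 2) :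
    ∃ Dec : (Fin N → Option (ZMod 2)) → Option M, ∀ (x : M) (r : R) (E : Finset (Fin N)),
      (∀ x' r', (∀ i ∉ E, Enc x' r' i = Enc x r i) → x' = x) →
        Dec (fun i => if i ∈ E then none else some (Enc x r i)) = some x := by
  classical
  let P : (Fin N → Option (ZMod 2)) → M → Prop := fun y x =>
    ∃ r, ∀ i, y i = none ∨ y i = some (Enc x r i)
  refine ⟨fun y => if h : ∃! x, P y x then some h.choose else none, fun x r E hx => ?_⟩
  have hP : ∀ x', P (fun i => if i ∈ E then none else some (Enc x r i)) x' → x' = x := by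
    rintro x' ⟨r', hr'⟩
    refine hx x' r' fun i hi => ?_
    simpa [hi, eq_comm] using hr' i
  have hu : ∃! x', P (fun i => if i ∈ E then none else some (Enc x r i)) x' := by
    refine ⟨x, ⟨r, fun i => ?_⟩, hP⟩
    by_cases hi : i ∈ E <;> simp [hi]
  simp only [dif_pos hu]
  rw [hP _ hu.choose_spec.1]

/-- A list-decodable linear code composed with an authentication code: the encoding of `x` with
coin `r` is the linear encoding of `x`, `r` and the tag `(authPoly x).eval r`. -/
lemma exists_stochastic_affine_code {k d : ℕ} (hk : k ≠ 0) (hd : Odd d) (L N : ℕ) :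
    ∃ (R : Type) (_ : Fintype R) (_ : Nonempty R)
      (Enc : (Fin (k * d) → ZMod 2) → R → Fin N → ZMod 2)
      (Dec : (Fin N → Option (ZMod 2)) → Option (Fin (k * d) → ZMod 2)),
      (∀ r : R, ∃ (T : (Fin (k * d) → ZMod 2) →ₗ[ZMod 2] (Fin N → ZMod 2))
        (Δ : Fin N → ZMod 2), ∀ x, Enc x r = T x + Δ) ∧
      ∀ (x : Fin (k * d) → ZMod 2) (E : Finset (Fin N)),
        N + k * (d + 2) * L < L * Eᶜ.card →
          1 - (2 : ℝ) ^ L * (d + 2) / 2 ^ k ≤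
            prob (fun r : R => Dec (fun i => if i ∈ E then none else some (Enc x r i)))
              (some x) := by
  classical
  let F := GaloisField 2 k
  let _ : Fintype F := Fintype.ofFinite F
  have hFfin : finrank (ZMod 2) F = k := GaloisField.finrank 2 hk
  have hF : Fintype.card F = 2 ^ k := by
    rw [← Nat.card_eq_fintype_card]; exact GaloisField.card 2 k hk
  let e : (Fin (k * d) → ZMod 2) ≃ₗ[ZMod 2] (Fin d → F) :=
    LinearEquiv.ofFinrankEq _ _ (by simp [finrank_pi_fintype, hFfin, mul_comm])
  have hV : finrank (ZMod 2) ((Fin d → F) × F × F) = k * (d + 2) := by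
    simp only [finrank_prod, finrank_pi_fintype, hFfin, Finset.sum_const, Finset.card_univ,
      Fintype.card_fin, smul_eq_mul]
    ring
  obtain ⟨G, hG⟩ := exists_erasure_list_decodable ((Fin d → F) × F × F) L N
  rw [hV] at hG
  let Enc : (Fin (k * d) → ZMod 2) → F → Fin N → ZMod 2 := fun x r i =>
    G i (e x, r, (authPoly (e x)).eval r)
  obtain ⟨Dec, hDec⟩ := exists_unique_decoder Enc
  refine ⟨F, inferInstance, ⟨0⟩, Enc, Dec, fun r => ?_, fun x E hE => ?_⟩
  · let T : (Fin d → F) →ₗ[ZMod 2] F :=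
      ∑ i : Fin d, (LinearMap.mulRight (ZMod 2) (r ^ ((i : ℕ) + 1))) ∘ₗ LinearMap.proj i
    refine ⟨LinearMap.pi fun i => G i ∘ₗ (LinearMap.id.prod ((0 : (Fin d → F) →ₗ[ZMod 2] F).prod T))
      ∘ₗ e.toLinearMap, fun i => G i (0, r, r ^ (d + 2)), fun x => ?_⟩
    ext i
    simp only [Enc, Pi.add_apply, LinearMap.pi_apply, LinearMap.comp_apply]
    rw [← map_add]
    congr 1
    simp [T, authPoly, eval_finsetSum]
  · let K : Finset ((Fin d → F) × F × F) := Finset.univ.filter fun v => ∀ i ∉ E, G i v = 0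
    have hK : K.card ≤ 2 ^ L := by
      have := hG E hE
      rwa [Nat.card_eq_fintype_card, Fintype.card_subtype] at this
    let S : (Fin d → F) × F × F → Finset F := fun v => Finset.univ.filter fun r =>
      v.1 ≠ 0 ∧ (authPoly (e x + v.1)).eval (r + v.2.1) = (authPoly (e x)).eval r + v.2.2
    have hS : ∀ v ∈ K, (S v).card ≤ d + 2 := by
      intro v _
      by_cases hv : v.1 = 0
      · simp [S, hv]
      · exact card_authPoly_collision_le hd (e x) v.1 v.2.1 v.2.2 hv _ fun r hr =>
          (Finset.mem_filter.1 hr).2.2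
    have hbad : (K.biUnion S).card ≤ 2 ^ L * (d + 2) :=
      (Finset.card_biUnion_le_card_mul _ _ _ hS).trans (Nat.mul_le_mul_right _ hK)
    have hgood : (K.biUnion S)ᶜ ⊆ Finset.univ.filter fun r : F =>
        Dec (fun i => if i ∈ E then none else some (Enc x r i)) = some x := by
      intro r hr
      refine Finset.mem_filter.2 ⟨Finset.mem_univ _, hDec x r E fun x' r' h => ?_⟩
      by_contra hne
      refine Finset.mem_compl.1 hr (Finset.mem_biUnion.2
        ⟨(e x' - e x, r' - r, (authPoly (e x')).eval r' - (authPoly (e x)).eval r), ?_, ?_⟩)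
      · refine Finset.mem_filter.2 ⟨Finset.mem_univ _, fun i hi => ?_⟩
        have h1 : G i (e x', r', (authPoly (e x')).eval r') -
          G i (e x, r, (authPoly (e x)).eval r) = 0 := sub_eq_zero.2 (h i hi)
        rwa [← map_sub] at h1
      · refine Finset.mem_filter.2 ⟨Finset.mem_univ _, ?_, ?_⟩
        · exact sub_ne_zero.2 fun h => hne (e.injective h)
        · simp
    have hcount : 2 ^ k ≤ (Finset.univ.filter fun r : F =>
        Dec (fun i => if i ∈ E then none else some (Enc x r i)) = some x).card +
          2 ^ L * (d + 2) := by
      have h1 := Finset.card_le_card hgood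
      rw [Finset.card_compl, hF] at h1
      omega
    have hcount' : (2 : ℝ) ^ k ≤ ((Finset.univ.filter fun r : F =>
        Dec (fun i => if i ∈ E then none else some (Enc x r i)) = some x).card : ℝ) +
          2 ^ L * (d + 2) := by exact_mod_cast hcount
    rw [prob, Nat.card_eq_fintype_card, Fintype.card_subtype, Nat.card_eq_fintype_card, hF]
    push_cast
    rw [sub_le_iff_le_add, ← add_div, one_le_div (by positivity)]
    exact hcount'

end Code

/-- for every `p ∈ [0,1)` and `ξ > 0` with `p + ξ < 1` there are a
constant `c > 0` and `N₀` such that for every `N ≥ N₀` there is a stochastic affine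
erasure-correcting code of length `N` and message length `m ≥ (1-p-ξ)·N`: the encoder
`Enc(·, r)` is affine for every fixed coin `r`, and for every message `x` and every
erasure pattern `E` of at most `p·N` coordinates, the deterministic decoder recovers
`x` from the erased codeword with probability at least `1 - exp(-c·ξ²·N/(log N)²)`. -/
theorem stmt_11 (p ξ : ℝ) (hp0 : 0 ≤ p) (hp1 : p < 1) (hξ : 0 < ξ) (hpξ : p + ξ < 1) :
    ∃ c : ℝ, 0 < c ∧ ∃ N₀ : ℕ, ∀ N : ℕ, N₀ ≤ N →
      ∃ (m : ℕ) (R : Type) (_ : Fintype R) (_ : Nonempty R)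
        (Enc : (Fin m → ZMod 2) → R → Fin N → ZMod 2)
        (Dec : (Fin N → Option (ZMod 2)) → Option (Fin m → ZMod 2)),
        (1 - p - ξ) * (N : ℝ) ≤ (m : ℝ) ∧
        (∀ r : R, ∃ (L : (Fin m → ZMod 2) →ₗ[ZMod 2] (Fin N → ZMod 2))
            (Δ : Fin N → ZMod 2), ∀ x, Enc x r = L x + Δ) ∧
        (∀ (x : Fin m → ZMod 2) (E : Finset (Fin N)), (E.card : ℝ) ≤ p * (N : ℝ) →
          1 - Real.exp (-(c * ξ ^ 2 * (N : ℝ) / (Real.log (N : ℝ)) ^ 2)) ≤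
            prob (fun r : R =>
              Dec (fun i => if i ∈ E then none else some (Enc x r i))) (some x)) := by
  obtain ⟨D, hD⟩ := exists_nat_ge (8 / ξ)
  obtain ⟨L, hL⟩ := exists_nat_gt (2 / ξ)
  set d : ℕ := 2 * D + 1 with hd
  set β : ℝ := 1 - p - ξ / 2 with hβ
  have hβ0 : 0 < β := by linarith
  have hβ1 : β ≤ 1 := by linarith
  have hd0 : (0 : ℝ) < (d : ℝ) + 2 := by positivity
  have hdξ : 8 ≤ ξ * ((d : ℝ) + 2) := by
    rw [div_le_iff₀ hξ] at hD
    have : (d : ℝ) = 2 * D + 1 := by rw [hd]; push_cast; ring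
    rw [this]
    nlinarith [(Nat.cast_nonneg D : (0 : ℝ) ≤ D)]
  have hLξ : 2 < L * ξ := (div_lt_iff₀ hξ).1 hL
  set γ : ℝ := β / (2 * (d + 2)) with hγ
  have hγ0 : 0 < γ := by positivity
  have hlog2 : 0 < Real.log 2 := Real.log_pos one_lt_two
  set κ : ℝ := γ * Real.log 2 / 2 with hκ
  have hκ0 : 0 < κ := by positivity
  have hcast : Filter.Tendsto (fun N : ℕ => (N : ℝ)) Filter.atTop Filter.atTop :=
    tendsto_natCast_atTop_atTop
  have hexp : Filter.Tendsto (fun N : ℕ => Real.exp (κ * N)) Filter.atTop Filter.atTop :=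
    Real.tendsto_exp_atTop.comp (hcast.const_mul_atTop hκ0)
  have hev := ((hcast.eventually_ge_atTop (4 * d / ξ)).and
    (hcast.eventually_ge_atTop (2 * (d + 2) / β))).and
    ((hcast.eventually_ge_atTop 3).and (hexp.eventually_ge_atTop (2 ^ L * ((d : ℝ) + 2))))
  obtain ⟨N₀, hN₀⟩ := Filter.eventually_atTop.1 hev
  refine ⟨κ / ξ ^ 2, by positivity, N₀, fun N hN => ?_⟩
  obtain ⟨⟨hN1, hN2⟩, hN3, hN4⟩ := hN₀ N hN
  have hNpos : (0 : ℝ) < N := by linarith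
  rw [div_le_iff₀ hξ] at hN1
  rw [div_le_iff₀ hβ0] at hN2
  set u : ℝ := β * N / (d + 2) with hu
  have hud : u * (d + 2) = β * N := div_mul_cancel₀ _ hd0.ne'
  have hu2 : 2 ≤ u := by
    rw [hu, le_div_iff₀ hd0]; linarith
  set k : ℕ := ⌊u⌋₊ with hk
  have hku : (k : ℝ) ≤ u := Nat.floor_le (by linarith)
  have huk : u < k + 1 := Nat.lt_floor_add_one u
  have hk0 : k ≠ 0 := by
    intro h
    rw [h] at huk
    norm_num at huk
    linarith
  obtain ⟨R, i₁, i₂, Enc, Dec, haff, hprob⟩ :=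
    exists_stochastic_affine_code hk0 (d := d) ⟨D, rfl⟩ L N
  refine ⟨k * d, R, i₁, i₂, Enc, Dec, ?_, haff, fun x E hE => ?_⟩
  · push_cast
    have h1 : u * 8 ≤ ξ * N := by
      calc u * 8 ≤ u * (ξ * (d + 2)) := by gcongr
        _ = ξ * (β * N) := by rw [← hud]; ring
        _ ≤ ξ * (1 * N) := by gcongr
        _ = ξ * N := by ring
    have h2 : (u - 1) * d ≤ k * d := by gcongr; linarith
    have h3 : (1 - p - ξ) * (N : ℝ) = β * N - ξ * N / 2 := by rw [hβ]; ring
    nlinarith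
  · refine le_trans ?_ (hprob x E ?_)
    · have h1 : (2 : ℝ) ^ k = Real.exp (k * Real.log 2) := by
        rw [Real.exp_nat_mul, Real.exp_log two_pos]
      have h2 : γ * N ≤ k := by
        have : γ * N = u / 2 := by rw [hγ, hu]; field_simp
        linarith
      have h3 : 1 ≤ Real.log N := by
        rw [Real.le_log_iff_exp_le hNpos]
        exact (Real.exp_one_lt_three.le).trans hN3
      have h4 : κ / ξ ^ 2 * ξ ^ 2 * N / Real.log N ^ 2 ≤ κ * N := by
        rw [div_mul_cancel₀ _ (by positivity)]
        exact div_le_self (by positivity) (one_le_pow₀ h3)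
      have h5 : 2 * κ * N ≤ k * Real.log 2 := by
        have : 2 * κ * N = γ * N * Real.log 2 := by rw [hκ]; ring
        rw [this]
        gcongr
      refine sub_le_sub_left ?_ 1
      rw [h1]
      calc 2 ^ L * ((d : ℝ) + 2) / Real.exp (k * Real.log 2)
          ≤ Real.exp (κ * N) / Real.exp (k * Real.log 2) := by gcongr
        _ = Real.exp (κ * N - k * Real.log 2) := (Real.exp_sub _ _).symm
        _ ≤ _ := Real.exp_le_exp.2 (by linarith)
    · have h1 : (E.card : ℝ) + Eᶜ.card = N := by
        exact_mod_cast (Finset.card_add_card_compl E).trans (Fintype.card_fin N)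
      have h2 : (k : ℝ) * (d + 2) ≤ β * N := by rw [← hud]; gcongr
      have h3 : (L : ℝ) * ((1 - p) * N) ≤ L * Eᶜ.card := by gcongr; linarith
      have h4 : (k : ℝ) * (d + 2) * L ≤ β * N * L := by gcongr
      have h5 : (N : ℝ) + k * (d + 2) * L < L * Eᶜ.card := by
        have h6 : 2 * (N : ℝ) < L * ξ * N := by gcongr
        have h7 : (L : ℝ) * ((1 - p) * N) = β * N * L + L * ξ * N / 2 := by rw [hβ]; ring
        linarith
      exact_mod_cast h5
end

section
/- Fix 0 ≤ τ < ρ ≤ 1 and R ∈ [0,1]. Suppose that for every N ∈ ℕ there is a non-adaptive (ε(N), δ(N))-secret sharing scheme with N players, secret length ℓ(N), privacy threshold t(N) = ⌊τN⌋ and reconstruction threshold r(N) = ⌈ρN⌉, where ε(·) and δ(·) are negligible functions and ℓ(N)/N → R as N → ∞. Then R ≤ ρ − τ. -/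
/-- `f : ℕ → ℝ` is negligible: for every `k > 0`, `|f N| < N⁻ᵏ` for all large `N`. -/
def Negligible (f : ℕ → ℝ) : Prop :=
  ∀ k : ℕ, 0 < k → ∃ N₀ : ℕ, ∀ N : ℕ, N₀ ≤ N → |f N| < ((N : ℝ) ^ k)⁻¹

/-- An `(ε,δ)`-secret sharing scheme with `N` players, secret length `ℓ`, privacy
threshold `t` and reconstruction threshold `r`, with non-adaptive privacy:
there are a finite nonempty set of coins `R`, a sharing map `Share` and a
reconstruction map `Recst` such that any `r` shares determine the secret with
probability `≥ 1 - δ`, and any `t` shares of two secrets are `ε`-close. -/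
def IsNonAdaptiveSSS (N ℓ t r : ℕ) (ε δ : ℝ) : Prop :=
  ∃ (R : Type) (_ : Fintype R) (_ : Nonempty R)
    (Share : (Fin ℓ → ZMod 2) → R → Fin N → ZMod 2)
    (Recst : (Fin N → Option (ZMod 2)) → Option (Fin ℓ → ZMod 2)),
    (∀ (s : Fin ℓ → ZMod 2) (B : Finset (Fin N)), r ≤ B.card →
      1 - δ ≤ prob (fun rc : R =>
        Recst (fun i => if i ∈ B then some (Share s rc i) else none)) (some s)) ∧
    (∀ (s₀ s₁ : Fin ℓ → ZMod 2) (A : Finset (Fin N)), A.card ≤ t →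
      SD (fun rc : R => fun i : A => Share s₀ rc i.1)
         (fun rc : R => fun i : A => Share s₁ rc i.1) ≤ ε)

/-- The masses of the values in `E` add up to the probability of landing in `E`. -/
theorem sum_prob_eq {Ω α : Type*} [Fintype Ω] [Fintype α] (X : Ω → α) (E : Finset α) :
    ∑ a ∈ E, prob X a = (Nat.card {ω : Ω // X ω ∈ E} : ℝ) / (Nat.card Ω : ℝ) := by
  classical
  simp only [prob]
  rw [← Finset.sum_div]
  congr 1
  simp only [Nat.card_eq_fintype_card, Fintype.card_subtype]
  rw [← Nat.cast_sum]
  congr 1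
  rw [Finset.card_eq_sum_card_fiberwise (f := X) (t := E) (fun ω hω => by simpa using hω)]
  refine Finset.sum_congr rfl fun a ha => congrArg _ ?_
  ext ω
  simp only [Finset.mem_filter, Finset.mem_univ, true_and]
  exact ⟨fun h => ⟨h ▸ ha, h⟩, fun h => h.2⟩

/-- An event which covers the event `Y = b` has at least its probability. -/
theorem prob_le_sum_prob {Ω α β : Type*} [Fintype Ω] [Fintype α] (X : Ω → α) (Y : Ω → β)
    (b : β) (E : Finset α) (h : ∀ ω, Y ω = b → X ω ∈ E) :
    prob Y b ≤ ∑ a ∈ E, prob X a := by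
  rw [sum_prob_eq, prob]
  gcongr
  exact Nat.card_le_card_of_injective (Subtype.impEmbedding _ _ h)
    (Subtype.impEmbedding _ _ h).injective

theorem sum_prob_sub_le_two_mul_SD {Ω₁ Ω₂ α : Type*} [Fintype α] (X : Ω₁ → α) (Y : Ω₂ → α)
    (E : Finset α) :
    ∑ a ∈ E, prob X a - ∑ a ∈ E, prob Y a ≤ 2 * SD X Y := by
  have h : ∑ a ∈ E, prob X a - ∑ a ∈ E, prob Y a ≤ ∑ a, |prob X a - prob Y a| := by
    rw [← Finset.sum_sub_distrib]
    calc ∑ a ∈ E, (prob X a - prob Y a) ≤ ∑ a ∈ E, |prob X a - prob Y a| :=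
          Finset.sum_le_sum fun a _ => le_abs_self _
      _ ≤ _ := Finset.sum_le_sum_of_subset_of_nonneg (Finset.subset_univ _)
          fun a _ _ => abs_nonneg _
  rw [SD]
  linarith

/-- Extending the `t` private shares to `r` shares in all `2 ^ (r - t)` ways yields a list of
candidate secrets which contains any fixed secret with probability at least `1 - δ - 2 ε`. -/
theorem IsNonAdaptiveSSS.two_pow_mul_le {N ℓ t r : ℕ} {ε δ : ℝ}
    (h : IsNonAdaptiveSSS N ℓ t r ε δ) (htr : t ≤ r) (hrN : r ≤ N) :
    (2 : ℝ) ^ ℓ * (1 - δ - 2 * ε) ≤ 2 ^ (r - t) := by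
  classical
  obtain ⟨R, _, _, Share, Recst, hrec, hpriv⟩ := h
  obtain ⟨B, -, hB⟩ := Finset.exists_subset_card_eq (s := (Finset.univ : Finset (Fin N)))
    (n := r) (by simpa using hrN)
  obtain ⟨A, hAB, hA⟩ := Finset.exists_subset_card_eq (s := B) (n := t) (by omega)
  let view (s : Fin ℓ → ZMod 2) (rc : R) (i : A) : ZMod 2 := Share s rc i.1
  let extend (a : A → ZMod 2) (c : (B \ A : Finset (Fin N)) → ZMod 2) (i : Fin N) :
      Option (ZMod 2) :=
    if hi : i ∈ A then some (a ⟨i, hi⟩) else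
      if hc : i ∈ B \ A then some (c ⟨i, hc⟩) else none
  let E (s : Fin ℓ → ZMod 2) : Finset (A → ZMod 2) :=
    Finset.univ.filter fun a => ∃ c, Recst (extend a c) = some s
  have hextend (s : Fin ℓ → ZMod 2) (rc : R) :
      extend (view s rc) (fun i => Share s rc i.1) =
        fun i => if i ∈ B then some (Share s rc i) else none := by
    funext i
    by_cases hiA : i ∈ A
    · simp [extend, view, hiA, hAB hiA]
    · by_cases hiB : i ∈ B <;> simp [extend, hiA, hiB]
  have hlower (s : Fin ℓ → ZMod 2) : 1 - δ - 2 * ε ≤ ∑ a ∈ E s, prob (view 0) a := by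
    have hrecs := (hrec s B hB.ge).trans (prob_le_sum_prob (view s) _ _ (E s) fun rc hrc => by
      simp only [E, Finset.mem_filter, Finset.mem_univ, true_and]
      exact ⟨fun i => Share s rc i.1, by rw [hextend]; exact hrc⟩)
    have hdist := sum_prob_sub_le_two_mul_SD (view s) (view 0) (E s)
    have hSD : SD (view s) (view 0) ≤ ε := hpriv s 0 A hA.le
    linarith
  have hlist (a : A → ZMod 2) :
      (((Finset.univ.filter fun s => a ∈ E s).card : ℕ) : ℝ) ≤ 2 ^ (r - t) := by
    have hcard : (Finset.univ.filter fun s => a ∈ E s).card ≤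
        (Finset.univ : Finset ((B \ A : Finset (Fin N)) → ZMod 2)).card := by
      rw [← Finset.card_image_of_injective (Finset.univ.filter fun s => a ∈ E s)
        (Option.some_injective _)]
      refine (Finset.card_le_card fun o ho => ?_).trans
        (Finset.card_image_le (f := fun c => Recst (extend a c)))
      obtain ⟨s, hs, rfl⟩ := Finset.mem_image.1 ho
      simpa [E] using hs
    rw [Finset.card_univ, Fintype.card_fun, Fintype.card_coe, ZMod.card,
      Finset.card_sdiff_of_subset hAB, hA, hB] at hcard
    exact_mod_cast hcard
  have hnonneg (a : A → ZMod 2) : 0 ≤ prob (view 0) a := by unfold prob; positivity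
  have htotal : ∑ a, prob (view 0) a = 1 := by
    rw [sum_prob_eq]
    simp
  calc (2 : ℝ) ^ ℓ * (1 - δ - 2 * ε)
      = ∑ _s : Fin ℓ → ZMod 2, (1 - δ - 2 * ε) := by
        rw [Finset.sum_const, nsmul_eq_mul]
        simp [ZMod.card]
    _ ≤ ∑ s : Fin ℓ → ZMod 2, ∑ a ∈ E s, prob (view 0) a :=
        Finset.sum_le_sum fun s _ => hlower s
    _ = ∑ a, ∑ s ∈ Finset.univ.filter (fun s => a ∈ E s), prob (view 0) a :=
        Finset.sum_comm' (by simp)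
    _ ≤ ∑ a, 2 ^ (r - t) * prob (view 0) a := by
        refine Finset.sum_le_sum fun a _ => ?_
        rw [Finset.sum_const, nsmul_eq_mul]
        exact mul_le_mul_of_nonneg_right (hlist a) (hnonneg a)
    _ = 2 ^ (r - t) := by rw [← Finset.mul_sum, htotal, mul_one]

theorem IsNonAdaptiveSSS.secret_length_le {N ℓ t r : ℕ} {ε δ : ℝ}
    (h : IsNonAdaptiveSSS N ℓ t r ε δ) (htr : t ≤ r) (hrN : r ≤ N)
    (hεδ : δ + 2 * ε ≤ 1 / 2) : ℓ ≤ r - t + 1 := by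
  have hpow : (2 : ℝ) ^ ℓ ≤ 2 ^ (r - t + 1) := by
    have := h.two_pow_mul_le htr hrN
    have hpos : (0 : ℝ) < 2 ^ ℓ := by positivity
    rw [pow_succ]
    nlinarith
  exact (pow_le_pow_iff_right₀ (one_lt_two : (1 : ℝ) < 2)).1 hpow

/-- if for every `N` there is a non-adaptive `(ε(N), δ(N))`-secret
sharing scheme with `N` players, secret length `ℓ(N)`, privacy threshold `⌊τN⌋` and
reconstruction threshold `⌈ρN⌉`, with `ε, δ` negligible and `ℓ(N)/N → R`, then
`R ≤ ρ - τ`. -/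
theorem stmt_12 (τ ρ Rate : ℝ) (hτ : 0 ≤ τ) (hτρ : τ < ρ) (hρ : ρ ≤ 1)
    (hRate0 : 0 ≤ Rate) (hRate1 : Rate ≤ 1)
    (ℓ : ℕ → ℕ) (ε δ : ℕ → ℝ)
    (hscheme : ∀ N : ℕ, IsNonAdaptiveSSS N (ℓ N) ⌊τ * (N : ℝ)⌋₊ ⌈ρ * (N : ℝ)⌉₊ (ε N) (δ N))
    (hε : Negligible ε) (hδ : Negligible δ)
    (hlim : Filter.Tendsto (fun N : ℕ => (ℓ N : ℝ) / (N : ℝ)) Filter.atTop (nhds Rate)) :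
    Rate ≤ ρ - τ := by
  have hbound : ∀ᶠ N : ℕ in Filter.atTop, (ℓ N : ℝ) / N ≤ (ρ - τ) + 3 / N := by
    obtain ⟨Nε, hNε⟩ := hε 1 one_pos
    obtain ⟨Nδ, hNδ⟩ := hδ 1 one_pos
    filter_upwards [Filter.eventually_ge_atTop Nε, Filter.eventually_ge_atTop Nδ,
      Filter.eventually_ge_atTop 8] with N hN₁ hN₂ hN₃
    have hN8 : (8 : ℝ) ≤ N := by exact_mod_cast hN₃
    have hinv : ((N : ℝ) ^ 1)⁻¹ ≤ 1 / 8 := by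
      rw [pow_one, inv_eq_one_div]
      gcongr
    have hεN := (le_abs_self _).trans (hNε N hN₁).le
    have hδN := (le_abs_self _).trans (hNδ N hN₂).le
    have hfloor := Nat.lt_floor_add_one (τ * (N : ℝ))
    have hceil := Nat.ceil_lt_add_one (show 0 ≤ ρ * (N : ℝ) by nlinarith)
    have htr : ⌊τ * (N : ℝ)⌋₊ ≤ ⌈ρ * (N : ℝ)⌉₊ :=
      (Nat.floor_le_ceil _).trans (Nat.ceil_mono (by gcongr))
    have hrN : ⌈ρ * (N : ℝ)⌉₊ ≤ N := Nat.ceil_le.2 (by nlinarith)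
    have hℓ := (hscheme N).secret_length_le htr hrN (by linarith)
    have hℓ' : (ℓ N : ℝ) ≤ ⌈ρ * (N : ℝ)⌉₊ - ⌊τ * (N : ℝ)⌋₊ + 1 := by
      rw [← Nat.cast_sub htr]
      exact_mod_cast hℓ
    have hNpos : (0 : ℝ) < N := by linarith
    rw [div_le_iff₀ hNpos, add_mul, div_mul_cancel₀ _ hNpos.ne']
    linarith
  have hlim' : Filter.Tendsto (fun N : ℕ => (ρ - τ) + 3 / (N : ℝ)) Filter.atTop
      (nhds (ρ - τ)) := by
    simpa using (tendsto_const_div_atTop_nhds_zero_nat (3 : ℝ)).const_add (ρ - τ)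
  exact le_of_tendsto_of_tendsto hlim hlim' hbound
end

section
/- For every 0 ≤ τ < ρ ≤ 1 there exist, for every N ∈ ℕ, a non-adaptive (ε(N), δ(N))-secret sharing scheme with N players, secret length ℓ(N), privacy threshold t(N) = ⌊τN⌋ and reconstruction threshold r(N) = ⌈ρN⌉, such that ε(·) and δ(·) are negligible functions and ℓ(N)/N → ρ − τ as N → ∞ (i.e., the coding rate is ρ − τ − o(1)). -/
open Finset in
/-- Multiplicative Chernoff upper tail, in counting form: few functions `g : R → α` hit a set of
density at most `q` noticeably more often than expected. -/
theorem card_hits_gt_le {R α : Type*} [Fintype R] [Fintype α] [DecidableEq R] [DecidableEq α]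
    (T : Finset α) {q η : ℝ} (hq : 0 ≤ q) (hη₀ : 0 ≤ η) (hη₁ : η ≤ 1)
    (hT : (#T : ℝ) ≤ q * Fintype.card α) :
    (#{g : R → α | (1 + 2 * η) * (Fintype.card R * q) < #{x | g x ∈ T}} : ℝ) ≤
      Real.exp (-(η ^ 2 * (Fintype.card R * q))) * Fintype.card (R → α) := by
  set K : ℝ := (1 + 2 * η) * (Fintype.card R * q) with hK
  set w : α → ℝ := fun a => if a ∈ T then Real.exp η else 1 with hw
  have hcount (g : R → α) : ∏ x, w (g x) = Real.exp (η * #{x | g x ∈ T}) := by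
    rw [hw, Finset.prod_ite]
    simp [← Real.exp_nat_mul, mul_comm]
  have hmarkov : (#{g : R → α | K < #{x | g x ∈ T}} : ℝ) * Real.exp (η * K) ≤
      ∑ g : R → α, ∏ x, w (g x) := by
    rw [← nsmul_eq_mul, ← Finset.sum_const]
    refine (Finset.sum_le_sum fun g hg => ?_).trans
      (Finset.sum_le_sum_of_subset_of_nonneg (Finset.filter_subset _ _) fun g _ _ => ?_)
    · rw [hcount]
      have := (Finset.mem_filter.mp hg).2
      gcongr
    · rw [hcount]; positivity
  have hexp : Real.exp η - 1 ≤ η + η ^ 2 := by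
    have := (abs_le.mp (Real.abs_exp_sub_one_sub_id_le (x := η) (by rwa [abs_of_nonneg hη₀]))).2
    linarith
  have hsum : ∑ a, w a ≤ Real.exp (q * (η + η ^ 2)) * Fintype.card α := by
    have h : ∑ a, w a = Fintype.card α + #T * (Real.exp η - 1) := by
      have (a : α) : w a = 1 + if a ∈ T then Real.exp η - 1 else 0 := by
        simp only [hw]; split_ifs <;> ring
      simp [this, Finset.sum_add_distrib, mul_sub]
    have h0 : 0 ≤ Real.exp η - 1 := by linarith [Real.add_one_le_exp η]
    calc ∑ a, w a ≤ Fintype.card α + q * Fintype.card α * (η + η ^ 2) := by rw [h]; gcongr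
      _ = (q * (η + η ^ 2) + 1) * Fintype.card α := by ring
      _ ≤ _ := by gcongr; exact Real.add_one_le_exp _
  have hmoment : ∑ g : R → α, ∏ x, w (g x) ≤
      Real.exp (Fintype.card R * (q * (η + η ^ 2))) * Fintype.card (R → α) := by
    have h : ∑ g : R → α, ∏ x, w (g x) = (∑ a, w a) ^ Fintype.card R := by
      have := (Finset.prod_univ_sum (fun _ : R => (univ : Finset α)) fun _ a => w a).symm
      simpa using this
    have h0 : 0 ≤ ∑ a, w a := Finset.sum_nonneg fun a _ => by simp only [hw]; split_ifs <;> positivity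
    rw [h, Fintype.card_fun, Real.exp_nat_mul, Nat.cast_pow, ← mul_pow]
    gcongr
  have hpos := Real.exp_pos (η * K)
  refine le_of_mul_le_mul_right ((hmarkov.trans hmoment).trans_eq ?_) hpos
  rw [mul_right_comm, ← Real.exp_add]
  congr 2
  rw [hK]; ring

open Finset in
/-- A bound on the density of a property, uniform over resampling one coordinate, is a bound on
its density. -/
theorem card_filter_le_of_update {S G : Type*} [Fintype S] [DecidableEq S] [Fintype G]
    [Nonempty G] (P : (S → G) → Prop) [DecidablePred P] (s : S) (θ : ℝ)
    (h : ∀ F : S → G, (#{g | P (Function.update F s g)} : ℝ) ≤ θ * Fintype.card G) :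
    (#{F | P F} : ℝ) ≤ θ * Fintype.card (S → G) := by
  have hswap : ∑ p : (S → G) × G, (if P (Function.update p.1 s p.2) then (1 : ℝ) else 0) =
      ∑ p : (S → G) × G, if P p.1 then (1 : ℝ) else 0 := by
    refine Finset.sum_nbij' (fun p => (Function.update p.1 s p.2, p.1 s))
      (fun p => (Function.update p.1 s p.2, p.1 s)) ?_ ?_ ?_ ?_ ?_ <;> simp
  have hG : (0 : ℝ) < Fintype.card G := by exact_mod_cast Fintype.card_pos
  refine le_of_mul_le_mul_right ?_ hG
  calc (#{F | P F} : ℝ) * Fintype.card G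
      = ∑ p : (S → G) × G, if P p.1 then (1 : ℝ) else 0 := by
        rw [Fintype.sum_prod_type]
        change _ = ∑ F : S → G, ∑ _g : G, if P F then (1 : ℝ) else 0
        simp only [Finset.sum_const, Finset.card_univ, nsmul_eq_mul]
        rw [← Finset.mul_sum, Finset.sum_boole, mul_comm]
    _ = ∑ F : S → G, (#{g | P (Function.update F s g)} : ℝ) := by
        rw [← hswap, Fintype.sum_prod_type]; simp
    _ ≤ ∑ _F : S → G, θ * Fintype.card G := Finset.sum_le_sum fun F _ => h F
    _ = _ := by simp; ring

open Finset in
/-- Union bound: finitely many properties of small total density can be avoided at once. -/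
theorem exists_forall_not_of_card_le {I Ω : Type*} [Fintype I] [Fintype Ω] [Nonempty Ω]
    (P : I → Ω → Prop) [∀ i, DecidablePred (P i)] (θ : ℝ)
    (h : ∀ i, (#{x | P i x} : ℝ) ≤ θ * Fintype.card Ω) (hθ : Fintype.card I * θ < 1) :
    ∃ x, ∀ i, ¬ P i x := by
  classical
  by_contra! hall
  have hcover : (univ : Finset Ω) ⊆ univ.biUnion fun i => {x | P i x} := by
    intro x _
    simpa using hall x
  have hcard : (Fintype.card Ω : ℝ) ≤ ∑ i, (#{x | P i x} : ℝ) := by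
    exact_mod_cast (Finset.card_le_card hcover).trans Finset.card_biUnion_le
  have hΩ : (0 : ℝ) < Fintype.card Ω := by exact_mod_cast Fintype.card_pos
  have : ∑ i, (#{x | P i x} : ℝ) ≤ Fintype.card I * θ * Fintype.card Ω := by
    refine (Finset.sum_le_sum fun i _ => h i).trans_eq ?_
    simp; ring
  nlinarith

open Finset in
/-- The number of binary words with prescribed values on `A`. -/
theorem card_agreeing_words {N : ℕ} (A : Finset (Fin N)) (v : Fin N → ZMod 2) :
    (#{x : Fin N → ZMod 2 | ∀ i ∈ A, x i = v i} : ℝ) =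
      ((2 : ℝ) ^ #A)⁻¹ * Fintype.card (Fin N → ZMod 2) := by
  have h : ({x : Fin N → ZMod 2 | ∀ i ∈ A, x i = v i} : Finset _) =
      Fintype.piFinset fun i => if i ∈ A then {v i} else univ := by
    ext x
    simp only [mem_filter, mem_univ, true_and, Fintype.mem_piFinset]
    refine forall_congr' fun i => ?_
    split_ifs with hi <;> simp [hi]
  have hc : #({x : Fin N → ZMod 2 | ∀ i ∈ A, x i = v i} : Finset _) = 2 ^ (N - #A) := by
    rw [h, Fintype.card_piFinset]
    have (i : Fin N) : #(if i ∈ A then {v i} else univ : Finset (ZMod 2)) =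
        if i ∈ A then 1 else 2 := by split_ifs <;> simp [ZMod.card]
    simp only [this, Finset.prod_ite, Finset.prod_const, one_pow, one_mul]
    congr 1
    rw [Finset.filter_not, Finset.card_sdiff_of_subset (Finset.filter_subset _ _)]
    simp
  have hA : #A ≤ N := by simpa using Finset.card_le_univ A
  rw [hc, Fintype.card_fun, ZMod.card, Fintype.card_fin]
  push_cast
  rw [pow_sub₀ _ two_ne_zero hA, mul_comm]

open Finset in
/-- A random encoding with `m = t + 3a` random bits and `ℓ + m + a ≤ r` spreads every secret almost
evenly over the views of at most `t` players, and makes collisions between distinct secrets rare on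
any `r` positions. -/
theorem exists_good_encoding {N ℓ m t r a : ℕ} (hℓ : ℓ ≤ N) (hm : t + 3 * a ≤ m)
    (hr : ℓ + m + a ≤ r) (ha : 3 * N + 1 < 2 ^ a) :
    ∃ F : (Fin ℓ → ZMod 2) → Fin (2 ^ m) → Fin N → ZMod 2,
      (∀ s (v : Fin N → ZMod 2) (A : Finset (Fin N)), #A ≤ t →
        (#{x | ∀ i ∈ A, F s x i = v i} : ℝ) ≤ (1 + 2 * (2 ^ a)⁻¹) * (2 ^ m * (2 ^ #A)⁻¹)) ∧
      (∀ s (B : Finset (Fin N)), r ≤ #B →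
        (#{x | ∃ s', s' ≠ s ∧ ∃ y, ∀ i ∈ B, F s x i = F s' y i} : ℝ) ≤
          3 * (2 ^ m * (2 ^ a)⁻¹)) := by
  classical
  let S := Fin ℓ → ZMod 2
  let α := Fin N → ZMod 2
  let G := Fin (2 ^ m) → α
  let P : S × α × Finset (Fin N) × Bool → (S → G) → Prop := fun p F =>
    if p.2.2.2 then #p.2.2.1 ≤ t ∧ (1 + 2 * (2 ^ a)⁻¹) * (2 ^ m * (2 ^ #p.2.2.1)⁻¹) <
        (#{x | ∀ i ∈ p.2.2.1, F p.1 x i = p.2.1 i} : ℝ)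
    else r ≤ #p.2.2.1 ∧ 3 * (2 ^ m * (2 ^ a)⁻¹) <
        (#{x | ∃ s', s' ≠ p.1 ∧ ∃ y, ∀ i ∈ p.2.2.1, F p.1 x i = F s' y i} : ℝ)
  have key : ∃ F, ∀ i, ¬ P i F := by
    refine exists_forall_not_of_card_le P (Real.exp (-2 ^ a)) ?_ ?_
    · rintro ⟨s, v, A, b⟩
      refine card_filter_le_of_update _ s _ fun F => ?_
      cases b with
      | true =>
        by_cases hA : #A ≤ t
        · have h1 : ((2 : ℝ) ^ a)⁻¹ ≤ 1 := inv_le_one_of_one_le₀ (one_le_pow₀ one_le_two)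
          have := card_hits_gt_le (R := Fin (2 ^ m)) ({x : α | ∀ i ∈ A, x i = v i})
            (q := ((2 : ℝ) ^ #A)⁻¹) (η := ((2 : ℝ) ^ a)⁻¹) (by positivity) (by positivity) h1
            (card_agreeing_words A v).le
          simp only [mem_filter, mem_univ, true_and, Fintype.card_fin, Nat.cast_pow,
            Nat.cast_ofNat] at this
          simp only [P, Function.update_self, hA, true_and, if_true]
          refine this.trans ?_
          gcongr
          have : (2 : ℝ) ^ a * 2 ^ (2 * a) * 2 ^ #A ≤ 2 ^ m := by
            rw [← pow_add, ← pow_add]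
            exact pow_le_pow_right₀ one_le_two (by omega)
          rw [inv_pow, ← pow_mul, mul_comm a 2, ← div_eq_mul_inv, inv_mul_eq_div, div_div,
            le_div_iff₀ (by positivity)]
          linarith
        · simp [P, hA]
          positivity
      | false =>
        by_cases hB : r ≤ #A
        · let T : Finset α := {x | ∃ s', s' ≠ s ∧ ∃ y, ∀ i ∈ A, x i = F s' y i}
          have hT : (#T : ℝ) ≤ ((2 : ℝ) ^ a)⁻¹ * Fintype.card α := by
            have hsub : T ⊆ (univ : Finset (S × Fin (2 ^ m))).biUnion
                fun p => {x | ∀ i ∈ A, x i = F p.1 p.2 i} := by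
              intro x hx
              obtain ⟨s', -, y, hy⟩ := (mem_filter.mp hx).2
              simp only [mem_biUnion, mem_filter, mem_univ, true_and]
              exact ⟨(s', y), hy⟩
            have hle : (#T : ℝ) ≤ ∑ p : S × Fin (2 ^ m), (#{x : α | ∀ i ∈ A, x i = F p.1 p.2 i} : ℝ) := by
              exact_mod_cast (card_le_card hsub).trans card_biUnion_le
            refine hle.trans ?_
            simp only [α, card_agreeing_words, sum_const, card_univ, Fintype.card_prod, nsmul_eq_mul]
            rw [← mul_assoc]
            gcongr
            have : (2 : ℝ) ^ ℓ * 2 ^ m * 2 ^ a ≤ 2 ^ #A := by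
              rw [← pow_add, ← pow_add]
              exact pow_le_pow_right₀ one_le_two (by omega)
            simp only [S, Fintype.card_fun, ZMod.card, Fintype.card_fin]
            push_cast
            rw [← div_eq_mul_inv, ← one_div, div_le_div_iff₀ (by positivity) (by positivity)]
            linarith
          have := card_hits_gt_le (R := Fin (2 ^ m)) T (η := 1) (by positivity) zero_le_one le_rfl hT
          simp only [T, mem_filter, mem_univ, true_and, Fintype.card_fin, Nat.cast_pow,
            Nat.cast_ofNat] at this
          have hP (g : G) : P (s, v, A, false) (Function.update F s g) ↔
              (1 + 2 * 1) * ((2 : ℝ) ^ m * (2 ^ a)⁻¹) <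
                (#{x | ∃ s', s' ≠ s ∧ ∃ y, ∀ i ∈ A, g x i = F s' y i} : ℝ) := by
            have h3 : (1 + 2 * 1 : ℝ) = 3 := by norm_num
            have hset : ({x | ∃ s', s' ≠ s ∧ ∃ y, ∀ i ∈ A,
                Function.update F s g s x i = Function.update F s g s' y i} : Finset (Fin (2 ^ m))) =
                ({x | ∃ s', s' ≠ s ∧ ∃ y, ∀ i ∈ A, g x i = F s' y i} : Finset (Fin (2 ^ m))) := by
              ext x
              simp only [mem_filter, mem_univ, true_and, Function.update_self]
              refine exists_congr fun s' => and_congr_right fun hs' => ?_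
              rw [Function.update_of_ne hs']
            simp only [P, hB, true_and, h3, Bool.false_eq_true, if_false, hset]
          simp only [hP]
          refine this.trans ?_
          gcongr
          have : (2 : ℝ) ^ a * 2 ^ a ≤ 2 ^ m := by
            rw [← pow_add]
            exact pow_le_pow_right₀ one_le_two (by omega)
          rw [one_pow, one_mul, ← div_eq_mul_inv, le_div_iff₀ (by positivity)]
          exact this
        · simp [P, hB]
          positivity
    · have hcard : (Fintype.card (S × α × Finset (Fin N) × Bool) : ℝ) ≤ 2 ^ (3 * N + 1) := by
        have : Fintype.card (S × α × Finset (Fin N) × Bool) = 2 ^ (ℓ + N + N + 1) := by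
          simp [S, α, Fintype.card_prod, ZMod.card, pow_add, mul_assoc]
        rw [this]
        push_cast
        exact pow_le_pow_right₀ one_le_two (by omega)
      have h2 : (2 : ℝ) ^ (3 * N + 1) ≤ Real.exp ((3 * N + 1 : ℕ) : ℝ) := by
        rw [← mul_one ((3 * N + 1 : ℕ) : ℝ), Real.exp_nat_mul]
        gcongr
        linarith [Real.add_one_le_exp (1 : ℝ)]
      have h3 : ((3 * N + 1 : ℕ) : ℝ) < 2 ^ a := by exact_mod_cast ha
      calc _ ≤ Real.exp ((3 * N + 1 : ℕ) : ℝ) * Real.exp (-2 ^ a) := by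
            gcongr
            exact hcard.trans h2
        _ < 1 := by
          rw [← Real.exp_add, Real.exp_lt_one_iff]
          linarith
  obtain ⟨F, hF⟩ := key
  refine ⟨F, fun s v A hA => ?_, fun s B hB => ?_⟩
  · simpa [P, hA] using hF (s, v, A, true)
  · simpa [P, hB] using hF (s, 0, B, false)

open Finset in
theorem prob_eq_card_filter {Ω α : Type*} [Fintype Ω] [DecidableEq α] (X : Ω → α) (a : α) :
    prob X a = (#{ω | X ω = a} : ℝ) / Fintype.card Ω := by
  classical
  rw [prob, Nat.card_eq_fintype_card, Nat.card_eq_fintype_card, Fintype.card_subtype]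

theorem sum_prob_eq_one {Ω α : Type*} [Fintype Ω] [Nonempty Ω] [Fintype α] (X : Ω → α) :
    ∑ a, prob X a = 1 := by
  classical
  simp only [prob_eq_card_filter]
  rw [← Finset.sum_div, div_eq_one_iff_eq (by exact_mod_cast Fintype.card_ne_zero)]
  exact_mod_cast (Finset.card_eq_sum_card_fiberwise (f := X) (s := Finset.univ)
    (t := Finset.univ) (by simp)).symm

/-- Two distributions with pointwise common upper bound `u` are close when `u` has small excess
mass. -/
theorem SD_le_of_prob_le {Ω₁ Ω₂ α : Type*} [Fintype Ω₁] [Nonempty Ω₁] [Fintype Ω₂] [Nonempty Ω₂]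
    [Fintype α] (X : Ω₁ → α) (Y : Ω₂ → α) (u : ℝ) (hX : ∀ a, prob X a ≤ u)
    (hY : ∀ a, prob Y a ≤ u) : SD X Y ≤ Fintype.card α * u - 1 := by
  have h : ∑ a, |prob X a - prob Y a| ≤ ∑ a, (2 * u - prob X a - prob Y a) :=
    Finset.sum_le_sum fun a _ => abs_le.mpr
      ⟨by linarith [hX a, hY a], by linarith [hX a, hY a]⟩
  rw [Finset.sum_sub_distrib, Finset.sum_sub_distrib, sum_prob_eq_one, sum_prob_eq_one,
    Finset.sum_const, nsmul_eq_mul, Finset.card_univ] at h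
  rw [SD]
  linarith

theorem isNonAdaptiveSSS_zero (N t r : ℕ) {ε δ : ℝ} (hε : 0 ≤ ε) (hδ : 0 ≤ δ) :
    IsNonAdaptiveSSS N 0 t r ε δ := by
  refine ⟨Unit, inferInstance, inferInstance, fun _ _ _ => 0, fun _ => some 0, ?_, ?_⟩
  · intro s B _
    rw [Subsingleton.elim s 0]
    simp [prob, hδ]
  · intro s₀ s₁ A _
    simpa [SD] using hε

open Finset in
theorem isNonAdaptiveSSS_of_slack {N ℓ t r a : ℕ} (hℓ : ℓ ≤ N) (hr : ℓ + t + 4 * a ≤ r)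
    (ha : 3 * N + 1 < 2 ^ a) :
    IsNonAdaptiveSSS N ℓ t r (2 * ((2 : ℝ) ^ a)⁻¹) (3 * ((2 : ℝ) ^ a)⁻¹) := by
  classical
  obtain ⟨m, hm⟩ : ∃ m, m = t + 3 * a := ⟨_, rfl⟩
  obtain ⟨F, hpriv, hrec⟩ := exists_good_encoding hℓ hm.ge (show ℓ + m + a ≤ r by omega) ha
  have hM : (0 : ℝ) < 2 ^ m := by positivity
  let C (y : Fin N → Option (ZMod 2)) (s : Fin ℓ → ZMod 2) : Prop :=
    ∃ x, ∀ i b, y i = some b → F s x i = b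
  refine ⟨Fin (2 ^ m), inferInstance, inferInstance, F,
    fun y => if h : ∃ s, C y s then some h.choose else none, ?_, ?_⟩
  · intro s B hB
    rw [prob_eq_card_filter, Fintype.card_fin]
    push_cast
    rw [le_div_iff₀ hM]
    have hcover : (univ : Finset (Fin (2 ^ m))) ⊆
        ({x | ∃ s', s' ≠ s ∧ ∃ y, ∀ i ∈ B, F s x i = F s' y i} : Finset _) ∪
        ({x | (if h : ∃ s', C (fun i => if i ∈ B then some (F s x i) else none) s'
          then some h.choose else none) = some s} : Finset _) := by
      intro x _
      simp only [mem_union, mem_filter, mem_univ, true_and]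
      by_contra! hx
      obtain ⟨hx₁, hx₂⟩ := hx
      have h : ∃ s', C (fun i => if i ∈ B then some (F s x i) else none) s' := by
        refine ⟨s, x, fun i b hb => ?_⟩
        by_cases hi : i ∈ B <;> simp_all
      rw [dif_pos h] at hx₂
      obtain ⟨y, hy⟩ := h.choose_spec
      obtain ⟨i, hi, hne⟩ := hx₁ h.choose (fun e => hx₂ (congrArg some e)) y
      exact hne (hy i (F s x i) (by simp [hi])).symm
    have hcard := (card_le_card hcover).trans (card_union_le _ _)
    rw [card_univ, Fintype.card_fin] at hcard
    have hcard' : ((2 ^ m : ℕ) : ℝ) ≤ _ := Nat.cast_le.mpr hcard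
    push_cast at hcard'
    have := hrec s B hB
    linarith
  · intro s₀ s₁ A hA
    have hp (s : Fin ℓ → ZMod 2) (w : A → ZMod 2) :
        prob (fun x : Fin (2 ^ m) => fun i : A => F s x i.1) w ≤
          (1 + 2 * (2 ^ a)⁻¹) * (2 ^ #A)⁻¹ := by
      have h := hpriv s (fun i => if h : i ∈ A then w ⟨i, h⟩ else 0) A hA
      have hset : ({x | ∀ i ∈ A, F s x i = if h : i ∈ A then w ⟨i, h⟩ else 0} :
          Finset (Fin (2 ^ m))) = ({x | (fun i : A => F s x i.1) = w} : Finset _) := by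
        ext x
        simp only [mem_filter, mem_univ, true_and, funext_iff, Subtype.forall]
        refine forall₂_congr fun i hi => ?_
        rw [dif_pos hi]
      rw [hset] at h
      rw [prob_eq_card_filter, Fintype.card_fin]
      push_cast
      rw [div_le_iff₀ hM]
      linarith
    refine (SD_le_of_prob_le _ _ _ (hp s₀) (hp s₁)).trans_eq ?_
    rw [Fintype.card_fun, ZMod.card, Fintype.card_coe]
    push_cast
    field_simp
    ring

/-- `2 ^ √N` beats every polynomial. -/
theorem eventually_mul_pow_lt_two_pow_sqrt (c k : ℕ) :
    ∀ᶠ N : ℕ in Filter.atTop, c * (N + 1) ^ k < 2 ^ N.sqrt := by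
  have hlim : Filter.Tendsto (fun n : ℕ => (n : ℝ) ^ (2 * k) / 2 ^ n) Filter.atTop (nhds 0) :=
    tendsto_pow_const_div_const_pow_of_one_lt _ one_lt_two
  have hsqrt : Filter.Tendsto Nat.sqrt Filter.atTop Filter.atTop :=
    Filter.tendsto_atTop_atTop.mpr fun b => ⟨b * b, fun n hn => Nat.le_sqrt.mpr hn⟩
  have hshift : Filter.Tendsto (fun N : ℕ => N.sqrt + 1) Filter.atTop Filter.atTop :=
    (Filter.tendsto_add_atTop_nat 1).comp hsqrt
  have hpos : (0 : ℝ) < 1 / (2 * (c + 1)) := by positivity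
  filter_upwards [(hlim.comp hshift).eventually (gt_mem_nhds hpos)] with N hN
  simp only [Function.comp] at hN
  rw [div_lt_div_iff₀ (by positivity) (by positivity)] at hN
  have h1 : (N + 1) ^ k ≤ (N.sqrt + 1) ^ (2 * k) := by
    rw [pow_mul]
    gcongr
    rw [pow_two]
    exact Nat.succ_le_succ_sqrt N
  have h2 : (N.sqrt + 1) ^ (2 * k) * (2 * (c + 1)) < 1 * 2 ^ (N.sqrt + 1) := by exact_mod_cast hN
  rw [pow_succ] at h2
  have h3 : c * (N + 1) ^ k ≤ c * (N.sqrt + 1) ^ (2 * k) := Nat.mul_le_mul_left _ h1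
  calc c * (N + 1) ^ k ≤ c * (N.sqrt + 1) ^ (2 * k) := h3
    _ < 2 ^ N.sqrt := by nlinarith [Nat.zero_le ((N.sqrt + 1) ^ (2 * k))]

theorem negligible_const_mul_two_pow_sqrt_inv (c : ℕ) :
    Negligible fun N => c * ((2 : ℝ) ^ N.sqrt)⁻¹ := by
  intro k _
  obtain ⟨N₀, h⟩ := Filter.eventually_atTop.mp (eventually_mul_pow_lt_two_pow_sqrt c k)
  refine ⟨max N₀ 1, fun N hN => ?_⟩
  have hN1 : 0 < N := by omega
  have h1 : ((c * (N + 1) ^ k : ℕ) : ℝ) < ((2 ^ N.sqrt : ℕ) : ℝ) :=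
    Nat.cast_lt.mpr (h N (by omega))
  push_cast at h1
  have h2 : (c : ℝ) * (N : ℝ) ^ k ≤ c * ((N : ℝ) + 1) ^ k := by gcongr; linarith
  beta_reduce
  rw [abs_of_nonneg (by positivity), ← div_eq_mul_inv, ← one_div,
    div_lt_div_iff₀ (by positivity) (by positivity)]
  linarith

theorem tendsto_natSqrt_div_atTop :
    Filter.Tendsto (fun N : ℕ => (N.sqrt : ℝ) / N) Filter.atTop (nhds 0) := by
  have h : Filter.Tendsto (fun N : ℕ => (Real.sqrt N)⁻¹) Filter.atTop (nhds 0) :=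
    (Real.tendsto_sqrt_atTop.comp tendsto_natCast_atTop_atTop).inv_tendsto_atTop
  refine squeeze_zero (fun N => by positivity) (fun N => ?_) h
  rw [← Real.sqrt_div_self]
  gcongr
  exact Real.nat_sqrt_le_real_sqrt

/-- for every `0 ≤ τ < ρ ≤ 1` there are secret lengths `ℓ(N)` and
negligible functions `ε, δ` such that for every `N` there is a non-adaptive
`(ε(N), δ(N))`-secret sharing scheme with `N` players, secret length `ℓ(N)`, privacy
threshold `⌊τN⌋` and reconstruction threshold `⌈ρN⌉`, and `ℓ(N)/N → ρ - τ`
(coding rate `ρ - τ - o(1)`). -/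
theorem stmt_13 (τ ρ : ℝ) (hτ : 0 ≤ τ) (hτρ : τ < ρ) (hρ : ρ ≤ 1) :
    ∃ (ℓ : ℕ → ℕ) (ε δ : ℕ → ℝ),
      Negligible ε ∧ Negligible δ ∧
      Filter.Tendsto (fun N : ℕ => (ℓ N : ℝ) / (N : ℝ)) Filter.atTop (nhds (ρ - τ)) ∧
      ∀ N : ℕ, IsNonAdaptiveSSS N (ℓ N) ⌊τ * (N : ℝ)⌋₊ ⌈ρ * (N : ℝ)⌉₊ (ε N) (δ N) := by
  let a : ℕ → ℕ := Nat.sqrt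
  let r : ℕ → ℕ := fun N => ⌈ρ * (N : ℝ)⌉₊
  let t : ℕ → ℕ := fun N => ⌊τ * (N : ℝ)⌋₊
  let ℓ : ℕ → ℕ := fun N => if 3 * N + 1 < 2 ^ a N then r N - (t N + 4 * a N) else 0
  refine ⟨ℓ, fun N => (2 : ℕ) * ((2 : ℝ) ^ a N)⁻¹, fun N => (3 : ℕ) * ((2 : ℝ) ^ a N)⁻¹,
    negligible_const_mul_two_pow_sqrt_inv 2, negligible_const_mul_two_pow_sqrt_inv 3, ?_,
    fun N => ?_⟩
  · have hr : Filter.Tendsto (fun N : ℕ => (r N : ℝ) / N) Filter.atTop (nhds ρ) :=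
      (tendsto_nat_ceil_mul_div_atTop (hτ.trans hτρ.le)).comp tendsto_natCast_atTop_atTop
    have ht : Filter.Tendsto (fun N : ℕ => (t N : ℝ) / N) Filter.atTop (nhds τ) :=
      (tendsto_nat_floor_mul_div_atTop hτ).comp tendsto_natCast_atTop_atTop
    have hlim : Filter.Tendsto (fun N : ℕ => (r N : ℝ) / N - (t N : ℝ) / N - 4 * ((a N : ℝ) / N))
        Filter.atTop (nhds (ρ - τ)) := by
      simpa using (hr.sub ht).sub (tendsto_natSqrt_div_atTop.const_mul 4)
    refine hlim.congr' ?_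
    filter_upwards [hlim.eventually (lt_mem_nhds (sub_pos.mpr hτρ)),
      eventually_mul_pow_lt_two_pow_sqrt 3 1, Filter.eventually_gt_atTop 0] with N hN hbig hN0
    have hN0' : (0 : ℝ) < N := by exact_mod_cast hN0
    have heq : (r N : ℝ) / N - (t N : ℝ) / N - 4 * ((a N : ℝ) / N) =
        ((r N : ℝ) - (t N + 4 * a N)) / N := by ring
    have hle : t N + 4 * a N ≤ r N := by
      rw [heq, div_pos_iff_of_pos_right hN0', sub_pos] at hN
      exact_mod_cast hN.le
    have hcond : 3 * N + 1 < 2 ^ a N := by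
      rw [pow_one] at hbig
      exact lt_of_le_of_lt (by omega) hbig
    rw [heq]
    simp only [ℓ, if_pos hcond]
    push_cast [Nat.cast_sub hle]
    rfl
  · rcases Nat.eq_zero_or_pos (ℓ N) with h0 | hpos
    · rw [h0]
      exact isNonAdaptiveSSS_zero N _ _ (by positivity) (by positivity)
    · have hcond : 3 * N + 1 < 2 ^ a N := by
        by_contra h
        simp [ℓ, h] at hpos
      have hval : ℓ N = r N - (t N + 4 * a N) := if_pos hcond
      have hrN : r N ≤ N := Nat.ceil_le.mpr (mul_le_of_le_one_left (Nat.cast_nonneg N) hρ)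
      exact isNonAdaptiveSSS_of_slack (by omega) (show ℓ N + t N + 4 * a N ≤ r N by omega) hcond
end
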